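/- arXiv:math/0203059 — 2 statements merged into one kernel-verified Lean document; each statement's English description precedes it below -/
import Mathlib

section
/- Fix θ ∈ (0, π/2). Then for every ε > 0 there exists N such that for all integers n ≥ N, (1/n)·log M_LP(n,θ) ≥ (1/2)·log(1/sin θ) + (1/2)·[ ((1+sin θ)/(2 sin θ))·log((1+sin θ)/(2 sin θ)) − ((1−sin θ)/(2 sin θ))·log((1−sin θ)/(2 sin θ)) ] − ε, where log denotes the natural logarithm. -/
open Polynomial Set

/-- `IsJacobi α s P` says that `P` is the Jacobi polynomial `P_s^{(α,α)}`:
the unique real polynomial of degree `s` orthogonal to all lower-degree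
monomials with respect to the weight `(1 - t²)^α` on `(-1,1)`, normalized by
`P(1) = Γ(s+α+1)/(Γ(α+1)·s!)`. -/
def IsJacobi (α : ℝ) (s : ℕ) (P : Polynomial ℝ) : Prop :=
  P.degree = (s : ℕ) ∧
  (∀ j < s, (∫ t in (-1 : ℝ)..1, P.eval t * t ^ j * (1 - t ^ 2) ^ α) = 0) ∧
  P.eval 1 = Real.Gamma ((s : ℝ) + α + 1) / (Real.Gamma (α + 1) * (Nat.factorial s : ℝ))

/-- The weight function `w(t) = (1-t²)^{(n-3)/2}`. -/
noncomputable def jWeight (n : ℕ) (t : ℝ) : ℝ := (1 - t ^ 2) ^ (((n : ℝ) - 3) / 2)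

/-- `‖P‖₂ = (∫_{-1}^1 P(t)² (1-t²)^{(n-3)/2} dt)^{1/2}`. -/
noncomputable def jNorm (n : ℕ) (P : Polynomial ℝ) : ℝ :=
  Real.sqrt (∫ t in (-1 : ℝ)..1, (P.eval t) ^ 2 * jWeight n t)

/-- `M_LP(n,θ)`: infimum of `F(1)` over polynomials `F = Σ a_s P_s` with
`a_s ≥ 0`, `a_0 = 1`, and `F ≤ 0` on `[-1, cos θ]`. -/
noncomputable def MLP (θ : ℝ) (P : ℕ → Polynomial ℝ) : ℝ :=
  sInf { y : ℝ | ∃ (m : ℕ) (a : ℕ → ℝ) (F : Polynomial ℝ),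
    F = ∑ s ∈ Finset.range (m + 1), Polynomial.C (a s) * P s ∧
    (∀ s, 0 ≤ a s) ∧ a 0 = 1 ∧
    (∀ t ∈ Set.Icc (-1 : ℝ) (Real.cos θ), F.eval t ≤ 0) ∧ y = F.eval 1 }

/-- The integral of `p` over `[-1, 1]` against the weight `(1 - t²)^α`. -/
noncomputable def weightedIntegral (α : ℝ) (p : ℝ[X]) : ℝ :=
  ∫ t in (-1 : ℝ)..1, p.eval t * (1 - t ^ 2) ^ α

/-- The polynomial by which `(1 - t²)^α` has to be multiplied to give the derivative of
`(1 - t²)^(α + 1) f`. -/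
noncomputable def raise (α : ℝ) (f : ℝ[X]) : ℝ[X] :=
  (1 - X ^ 2) * derivative f - C (2 * (α + 1)) * X * f

/-- The Jacobi polynomial with parameters `(α, α)`, normalized to take the value `1` at `1`. -/
noncomputable def ultra : ℕ → ℝ → ℝ[X]
  | 0, _ => 1
  | s + 1, α => C (-1 / (2 * (α + 1))) * raise α (ultra s (α + 1))

section Weight

variable {α : ℝ}

lemma continuous_weight (hα : 0 ≤ α) : Continuous fun t : ℝ => (1 - t ^ 2) ^ α :=
  (by fun_prop : Continuous fun t : ℝ => 1 - t ^ 2).rpow_const fun _ => Or.inr hα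

lemma continuous_eval_mul_weight (hα : 0 ≤ α) (p : ℝ[X]) :
    Continuous fun t : ℝ => p.eval t * (1 - t ^ 2) ^ α :=
  p.continuous.mul (continuous_weight hα)

lemma one_sub_sq_nonneg {t : ℝ} (ht : t ∈ Icc (-1 : ℝ) 1) : 0 ≤ 1 - t ^ 2 := by
  nlinarith [ht.1, ht.2]

lemma weight_nonneg {t : ℝ} (ht : t ∈ Icc (-1 : ℝ) 1) : 0 ≤ (1 - t ^ 2) ^ α :=
  Real.rpow_nonneg (one_sub_sq_nonneg ht) _

lemma weight_succ (hα : 0 ≤ α) {t : ℝ} (ht : t ∈ Icc (-1 : ℝ) 1) :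
    (1 - t ^ 2) ^ (α + 1) = (1 - t ^ 2) ^ α * (1 - t ^ 2) := by
  rw [Real.rpow_add_of_nonneg (one_sub_sq_nonneg ht) hα zero_le_one, Real.rpow_one]

lemma hasDerivAt_weight (hα : 1 ≤ α) (t : ℝ) :
    HasDerivAt (fun t : ℝ => (1 - t ^ 2) ^ α) (-2 * α * t * (1 - t ^ 2) ^ (α - 1)) t := by
  have h : HasDerivAt (fun t : ℝ => 1 - t ^ 2) (-2 * t) t := by
    simpa using (hasDerivAt_pow 2 t).const_sub 1
  convert h.rpow_const (p := α) (Or.inr hα) using 1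
  ring

lemma weightedIntegral_add (hα : 0 ≤ α) (p q : ℝ[X]) :
    weightedIntegral α (p + q) = weightedIntegral α p + weightedIntegral α q := by
  unfold weightedIntegral
  rw [← intervalIntegral.integral_add
    ((continuous_eval_mul_weight hα p).intervalIntegrable _ _)
    ((continuous_eval_mul_weight hα q).intervalIntegrable _ _)]
  simp only [eval_add, add_mul]

lemma weightedIntegral_C_mul (a : ℝ) (p : ℝ[X]) :
    weightedIntegral α (C a * p) = a * weightedIntegral α p := by
  unfold weightedIntegral
  rw [← intervalIntegral.integral_const_mul]
  simp only [eval_mul, eval_C, mul_assoc]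

lemma weightedIntegral_sub (hα : 0 ≤ α) (p q : ℝ[X]) :
    weightedIntegral α (p - q) = weightedIntegral α p - weightedIntegral α q := by
  have := weightedIntegral_C_mul (α := α) (-1) q
  rw [sub_eq_add_neg, weightedIntegral_add hα, show -q = C (-1) * q by simp, this]
  ring

lemma weightedIntegral_sum (hα : 0 ≤ α) {ι : Type*} (u : Finset ι) (p : ι → ℝ[X]) :
    weightedIntegral α (∑ i ∈ u, p i) = ∑ i ∈ u, weightedIntegral α (p i) := by
  classical
  induction u using Finset.induction_on with
  | empty => simp [weightedIntegral]
  | insert i u hi ih => rw [Finset.sum_insert hi, Finset.sum_insert hi, weightedIntegral_add hα, ih]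

lemma weightedIntegral_nonneg {p : ℝ[X]} (hp : ∀ t ∈ Icc (-1 : ℝ) 1, 0 ≤ p.eval t) :
    0 ≤ weightedIntegral α p :=
  intervalIntegral.integral_nonneg (by norm_num) fun t ht => mul_nonneg (hp t ht) (weight_nonneg ht)

lemma weightedIntegral_one_sub_sq_mul (hα : 0 ≤ α) (p : ℝ[X]) :
    weightedIntegral α ((1 - X ^ 2) * p) = weightedIntegral (α + 1) p := by
  refine intervalIntegral.integral_congr fun t ht => ?_
  rw [uIcc_of_le (by norm_num)] at ht
  simp only [eval_mul, eval_sub, eval_one, eval_pow, eval_X, weight_succ hα ht]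
  ring

lemma weightedIntegral_sq_pos (hα : 0 ≤ α) {p : ℝ[X]} (hp : p ≠ 0) :
    0 < weightedIntegral α (p * p) := by
  have hfin : ((p.roots.toFinset : Set ℝ)).Finite := Finset.finite_toSet _
  obtain ⟨x, hx, hxp⟩ := ((Ioo_infinite (by norm_num : (-1 : ℝ) < 1)).sdiff hfin).nonempty
  refine intervalIntegral.integral_pos (by norm_num)
    (continuous_eval_mul_weight hα _).continuousOn
    (fun t ht => mul_nonneg (by rw [eval_mul]; exact mul_self_nonneg _)
      (weight_nonneg (Ioc_subset_Icc_self ht))) ⟨x, Ioo_subset_Icc_self hx, ?_⟩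
  have hne : p.eval x ≠ 0 := fun h => hxp (by simpa [hp] using h)
  rw [eval_mul]
  exact mul_pos (mul_self_pos.2 hne) (Real.rpow_pos_of_pos (by nlinarith [hx.1, hx.2]) _)

lemma weightedIntegral_raise (hα : 0 ≤ α) (f : ℝ[X]) : weightedIntegral α (raise α f) = 0 := by
  have hd : ∀ t ∈ uIcc (-1 : ℝ) 1, HasDerivAt (fun t : ℝ => f.eval t * (1 - t ^ 2) ^ (α + 1))
      ((raise α f).eval t * (1 - t ^ 2) ^ α) t := by
    intro t ht
    rw [uIcc_of_le (by norm_num)] at ht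
    refine ((f.hasDerivAt t).mul
      (hasDerivAt_weight (by linarith : 1 ≤ α + 1) t)).congr_deriv ?_
    rw [weight_succ hα ht, add_sub_cancel_right, raise]
    simp only [eval_mul, eval_sub, eval_one, eval_pow, eval_X, eval_C]
    ring
  rw [weightedIntegral, intervalIntegral.integral_eq_sub_of_hasDerivAt hd
    ((continuous_eval_mul_weight hα _).intervalIntegrable _ _)]
  norm_num [Real.zero_rpow (by linarith : α + 1 ≠ 0)]

lemma raise_mul (f g : ℝ[X]) :
    raise α (f * g) = raise α f * g + (1 - X ^ 2) * (f * derivative g) := by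
  simp only [raise, derivative_mul]
  ring

lemma weightedIntegral_raise_mul (hα : 0 ≤ α) (f g : ℝ[X]) :
    weightedIntegral α (raise α f * g) = -weightedIntegral (α + 1) (f * derivative g) := by
  have h := weightedIntegral_raise hα (f * g)
  rw [raise_mul, weightedIntegral_add hα, weightedIntegral_one_sub_sq_mul hα] at h
  linarith

lemma weightedIntegral_one_succ (hα : 0 ≤ α) :
    (2 * α + 3) * weightedIntegral (α + 1) 1 = (2 * α + 2) * weightedIntegral α 1 := by
  have h := weightedIntegral_raise hα X
  have h2 : raise α X = C (2 * α + 3) * ((1 - X ^ 2) * 1) - C (2 * α + 2) * 1 := by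
    simp only [raise, derivative_X, mul_add, C_add, C_mul, mul_one]
    have : (C 3 : ℝ[X]) = C 2 + 1 := by rw [← C_1, ← C_add]; norm_num
    rw [this]
    ring
  rw [h2, weightedIntegral_sub hα, weightedIntegral_C_mul, weightedIntegral_C_mul,
    weightedIntegral_one_sub_sq_mul hα] at h
  linarith

end Weight

section Ultraspherical

variable {α : ℝ}

lemma ultra_eval_one (hα : 0 ≤ α) (s : ℕ) : (ultra s α).eval 1 = 1 := by
  induction s generalizing α with
  | zero => simp [ultra]
  | succ s ih =>
    have := ih (by linarith : 0 ≤ α + 1)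
    simp only [ultra, raise, eval_mul, eval_sub, eval_C, eval_one, eval_pow, eval_X, this]
    have : α + 1 ≠ 0 := by linarith
    field_simp
    ring

lemma natDegree_raise_le (f : ℝ[X]) : (raise α f).natDegree ≤ f.natDegree + 1 := by
  by_cases hf : derivative f = 0
  · rw [raise, hf, mul_zero, zero_sub, natDegree_neg]
    compute_degree
    omega
  · have h1 : (derivative f).natDegree + 1 ≤ f.natDegree := by
      have : f.natDegree ≠ 0 := fun h => hf (derivative_of_natDegree_zero h)
      have := natDegree_derivative_lt this
      omega
    refine (natDegree_sub_le _ _).trans (max_le ?_ ?_)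
    · refine natDegree_mul_le.trans ?_
      have : (1 - X ^ 2 : ℝ[X]).natDegree ≤ 2 := by compute_degree
      omega
    · compute_degree
      omega

lemma coeff_raise (f : ℝ[X]) (s : ℕ) (hf : f.natDegree ≤ s) :
    (raise α f).coeff (s + 1) = -(s + 2 * (α + 1)) * f.coeff s := by
  have h : (raise α f) = derivative f - X * (X * derivative f) - C (2 * (α + 1)) * (X * f) := by
    rw [raise]; ring
  rw [h, coeff_sub, coeff_sub, coeff_C_mul, coeff_X_mul, coeff_X_mul]
  have h0 : (derivative f).coeff (s + 1) = 0 := by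
    rw [coeff_derivative, coeff_eq_zero_of_natDegree_lt (by omega), zero_mul]
  have h1 : (X * derivative f).coeff s = s * f.coeff s := by
    cases s with
    | zero => simp
    | succ s => rw [coeff_X_mul, coeff_derivative]; push_cast; ring
  rw [h0, h1]
  ring

lemma natDegree_ultra_le (s : ℕ) : (ultra s α).natDegree ≤ s := by
  induction s generalizing α with
  | zero => simp [ultra]
  | succ s ih =>
    refine (natDegree_C_mul_le _ _).trans ((natDegree_raise_le _).trans ?_)
    simpa using ih

lemma coeff_ultra_pos (hα : 0 ≤ α) (s : ℕ) : 0 < (ultra s α).coeff s := by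
  induction s generalizing α with
  | zero => simp [ultra]
  | succ s ih =>
    have h := ih (by linarith : 0 ≤ α + 1)
    rw [ultra, coeff_C_mul, coeff_raise _ _ (natDegree_ultra_le s)]
    have : -1 / (2 * (α + 1)) * (-(s + 2 * (α + 1)) * (ultra s (α + 1)).coeff s)
        = (s + 2 * (α + 1)) / (2 * (α + 1)) * (ultra s (α + 1)).coeff s := by ring
    rw [this]
    positivity

lemma ultra_ne_zero (hα : 0 ≤ α) (s : ℕ) : ultra s α ≠ 0 := fun h => by
  simpa [h] using coeff_ultra_pos hα s

lemma weightedIntegral_ultra_mul_succ (hα : 0 ≤ α) (s : ℕ) (g : ℝ[X]) :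
    weightedIntegral α (ultra (s + 1) α * g) =
      1 / (2 * (α + 1)) * weightedIntegral (α + 1) (ultra s (α + 1) * derivative g) := by
  rw [ultra, mul_assoc, weightedIntegral_C_mul, weightedIntegral_raise_mul hα]
  ring

lemma weightedIntegral_ultra_mul_eq_zero (hα : 0 ≤ α) {s : ℕ} {p : ℝ[X]}
    (hp : p.degree < s) : weightedIntegral α (ultra s α * p) = 0 := by
  induction s generalizing α p with
  | zero =>
    have : p = 0 := by simpa using hp
    simp [this, weightedIntegral]
  | succ s ih =>
    rw [weightedIntegral_ultra_mul_succ hα]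
    by_cases h0 : p = 0
    · simp [h0, weightedIntegral]
    · rw [ih (by linarith), mul_zero]
      have h1 := degree_derivative_lt h0
      have h2 : p.natDegree < s + 1 := (natDegree_lt_iff_degree_lt h0).2 hp
      rw [degree_eq_natDegree h0] at h1
      exact h1.trans_le (by exact_mod_cast Nat.lt_succ_iff.1 h2)

lemma derivative_raise (f : ℝ[X]) :
    derivative (raise α f) = raise (α + 1) (derivative f) - C (2 * (α + 1)) * f := by
  simp only [raise, derivative_sub, derivative_mul, derivative_C, derivative_X, derivative_one,
    derivative_X_pow, C_mul, C_add, C_1]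
  norm_num
  have : (C 2 : ℝ[X]) = 2 := rfl
  rw [this]
  ring

lemma raise_C_mul (a : ℝ) (f : ℝ[X]) : raise α (C a * f) = C a * raise α f := by
  simp only [raise, derivative_mul, derivative_C]
  ring

/-- The ultraspherical differential equation. -/
lemma raise_derivative_ultra (hα : 0 ≤ α) (s : ℕ) :
    raise α (derivative (ultra s α)) = C (-(s * (s + 2 * α + 1))) * ultra s α := by
  induction s generalizing α with
  | zero => simp [ultra, raise]
  | succ s ih =>
    have hne : α + 1 ≠ 0 := by linarith
    have h : derivative (raise α (ultra s (α + 1))) =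
        C (-((s + 1) * (s + 2 * α + 2))) * ultra s (α + 1) := by
      rw [derivative_raise, ih (by linarith), ← sub_mul, ← C_sub]
      congr 2
      ring
    rw [ultra, derivative_C_mul, h, raise_C_mul, raise_C_mul, ← mul_assoc, ← mul_assoc,
      ← C_mul, ← C_mul]
    congr 2
    push_cast
    ring

lemma derivative_ultra_succ (hα : 0 ≤ α) (s : ℕ) :
    derivative (ultra (s + 1) α) =
      C ((s + 1) * (s + 2 * α + 2) / (2 * (α + 1))) * ultra s (α + 1) := by
  rw [ultra, derivative_C_mul, derivative_raise, raise_derivative_ultra (by linarith), ← sub_mul,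
    ← C_sub, ← mul_assoc, ← C_mul]
  congr 2
  have hne : α + 1 ≠ 0 := by linarith
  field_simp
  ring

lemma prod_one_add_div_succ {a : ℝ} (s : ℕ) :
    (∏ i ∈ Finset.range s, (1 + (a + 2) / ((i : ℝ) + 1))) * ((a + 1) * (a + 2)) =
      (∏ i ∈ Finset.range (s + 1), (1 + a / ((i : ℝ) + 1))) * ((s + 1) * (s + a + 2)) := by
  induction s with
  | zero =>
    rw [Finset.prod_range_zero, Finset.prod_range_one]
    push_cast
    ring
  | succ s ih =>
    rw [Finset.prod_range_succ, Finset.prod_range_succ _ (s + 1), mul_right_comm, ih]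
    push_cast
    field_simp
    ring

lemma weightedIntegral_ultra_sq (hα : 0 ≤ α) (s : ℕ) :
    weightedIntegral α (ultra s α * ultra s α) =
      weightedIntegral α 1 * ((s + 2 * α + 1) / (2 * s + 2 * α + 1)) /
        ∏ i ∈ Finset.range s, (1 + (2 * α + 1) / (i + 1)) := by
  induction s generalizing α with
  | zero =>
    have : 2 * α + 1 ≠ 0 := by linarith
    simp [ultra, this]
  | succ s ih =>
    have hp : ∀ a : ℝ, 0 ≤ a → ∀ m : ℕ,
        (∏ i ∈ Finset.range m, (1 + a / ((i : ℝ) + 1))) ≠ 0 := fun a ha m =>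
      Finset.prod_ne_zero_iff.2 fun i _ => by positivity
    have h1 := hp (2 * α + 1) (by linarith) (s + 1)
    have h2 := hp (2 * α + 1 + 2) (by linarith) s
    have h3 := prod_one_add_div_succ (a := 2 * α + 1) s
    have h4 := weightedIntegral_one_succ hα
    rw [weightedIntegral_ultra_mul_succ hα, derivative_ultra_succ hα,
      mul_left_comm, weightedIntegral_C_mul, ih (by linarith),
      show 2 * (α + 1) + 1 = 2 * α + 1 + 2 by ring]
    generalize (∏ i ∈ Finset.range s, (1 + (2 * α + 1 + 2) / ((i : ℝ) + 1))) = A at *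
    generalize (∏ i ∈ Finset.range (s + 1), (1 + (2 * α + 1) / ((i : ℝ) + 1))) = B at *
    have h5 : weightedIntegral (α + 1) 1 =
        (2 * α + 2) / (2 * α + 3) * weightedIntegral α 1 := by
      field_simp
      linarith
    have h6 : A = B * ((s + 1) * (s + (2 * α + 1) + 2)) / ((2 * α + 1 + 1) * (2 * α + 1 + 2)) := by
      rw [← h3]
      field_simp
    rw [h5, h6]
    have e1 : (s : ℝ) + (2 * α + 1) + 2 ≠ 0 := by positivity
    have e2 : 2 * ((s : ℝ) + 1) + 2 * α + 1 ≠ 0 := by positivity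
    push_cast
    field_simp
    ring

lemma weightedIntegral_ultra_mul_pow_nonneg (hα : 0 ≤ α) (s N : ℕ) :
    0 ≤ weightedIntegral α (ultra s α * (1 + X) ^ N) := by
  induction s generalizing α N with
  | zero =>
    refine weightedIntegral_nonneg fun t ht => ?_
    simp only [ultra, one_mul, eval_pow, eval_add, eval_one, eval_X]
    exact pow_nonneg (by linarith [ht.1]) _
  | succ s ih =>
    rw [weightedIntegral_ultra_mul_succ hα]
    have h : ultra s (α + 1) * derivative ((1 + X) ^ N) =
        C (N : ℝ) * (ultra s (α + 1) * (1 + X) ^ (N - 1)) := by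
      rw [derivative_pow]
      simp
      ring
    rw [h, weightedIntegral_C_mul]
    have := ih (by linarith : 0 ≤ α + 1) (N - 1)
    positivity

end Ultraspherical

section Uniqueness

variable {α : ℝ}

lemma IsJacobi.weightedIntegral_mul_eq_zero (hα : 0 ≤ α) {s : ℕ} {P : ℝ[X]} (hP : IsJacobi α s P)
    {p : ℝ[X]} (hp : p.degree < s) : weightedIntegral α (P * p) = 0 := by
  by_cases h0 : p = 0
  · simp [h0, weightedIntegral]
  have hn : p.natDegree < s := (natDegree_lt_iff_degree_lt h0).2 hp
  rw [p.as_sum_range_C_mul_X_pow, Finset.mul_sum, weightedIntegral_sum hα]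
  refine Finset.sum_eq_zero fun i hi => ?_
  rw [mul_left_comm, weightedIntegral_C_mul]
  have h := hP.2.1 i (by have := Finset.mem_range.1 hi; omega)
  have h2 : weightedIntegral α (P * X ^ i) = 0 := by
    rw [← h]
    simp [weightedIntegral]
  rw [h2, mul_zero]

lemma IsJacobi.eq_C_mul_ultra (hα : 0 ≤ α) {s : ℕ} {P : ℝ[X]} (hP : IsJacobi α s P) :
    P = C (P.eval 1) * ultra s α := by
  set u := (ultra s α).coeff s with hu
  have hu0 : 0 < u := coeff_ultra_pos hα s
  have hPs : P.natDegree ≤ s := (natDegree_eq_of_degree_eq_some hP.1).le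
  obtain ⟨d, hd⟩ : ∃ d, d = C u * P - C (P.coeff s) * ultra s α := ⟨_, rfl⟩
  have hdeg : d.degree < s := by
    rw [degree_lt_iff_coeff_zero]
    intro m hm
    rcases hm.eq_or_lt with rfl | hm
    · rw [hd, coeff_sub, coeff_C_mul, coeff_C_mul]
      ring
    · rw [hd, coeff_sub, coeff_C_mul, coeff_C_mul, coeff_eq_zero_of_natDegree_lt (by omega),
        coeff_eq_zero_of_natDegree_lt ((natDegree_ultra_le s).trans_lt hm)]
      ring
  have hd0 : d = 0 := by
    by_contra hne
    have h := weightedIntegral_sq_pos hα hne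
    have h2 : d * d = C u * (P * d) - C (P.coeff s) * (ultra s α * d) := by
      nth_rewrite 1 [hd]
      ring
    rw [h2, weightedIntegral_sub hα, weightedIntegral_C_mul, weightedIntegral_C_mul,
      hP.weightedIntegral_mul_eq_zero hα hdeg, weightedIntegral_ultra_mul_eq_zero hα hdeg] at h
    simp at h
  have h1 : u * P.eval 1 = P.coeff s := by
    have := congrArg (eval 1) (hd.symm.trans hd0)
    simp only [eval_sub, eval_mul, eval_C, ultra_eval_one hα, eval_zero] at this
    linarith
  have h3 : C u * P = C u * (C (P.eval 1) * ultra s α) := by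
    rw [← mul_assoc, ← C_mul, h1]
    exact sub_eq_zero.1 (hd.symm.trans hd0)
  exact mul_left_cancel₀ (by simpa using hu0.ne') h3

lemma IsJacobi.eval_one_pos (hα : 0 ≤ α) {s : ℕ} {P : ℝ[X]} (hP : IsJacobi α s P) :
    0 < P.eval 1 := by
  rw [hP.2.2]
  have h1 := Real.Gamma_pos_of_pos (by positivity : 0 < (s : ℝ) + α + 1)
  have h2 := Real.Gamma_pos_of_pos (by positivity : 0 < α + 1)
  positivity

lemma IsJacobi.eval_one_zero (hα : 0 ≤ α) {P : ℝ[X]} (hP : IsJacobi α 0 P) : P.eval 1 = 1 := by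
  rw [hP.2.2]
  have h2 := Real.Gamma_pos_of_pos (by positivity : 0 < α + 1)
  simp [h2.ne']

end Uniqueness

section Monotonicity

variable {α : ℝ}

lemma hasDerivAt_eval_mul_weight (hα : 1 ≤ α) (p : ℝ[X]) {t : ℝ} (ht : t ∈ Icc (-1 : ℝ) 1) :
    HasDerivAt (fun t : ℝ => p.eval t * (1 - t ^ 2) ^ α)
      (((1 - t ^ 2) * (derivative p).eval t - 2 * α * t * p.eval t) * (1 - t ^ 2) ^ (α - 1)) t := by
  refine ((p.hasDerivAt t).mul (hasDerivAt_weight hα t)).congr_deriv ?_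
  have h := weight_succ (by linarith : 0 ≤ α - 1) ht
  rw [sub_add_cancel] at h
  rw [h]
  ring

lemma antitoneOn_eval_mul_weight (hα : 1 ≤ α) (p : ℝ[X]) {a : ℝ} (ha : 0 ≤ a)
    (hp : ∀ t ∈ Ioo a 1, (1 - t ^ 2) * (derivative p).eval t - 2 * α * t * p.eval t ≤ 0) :
    AntitoneOn (fun t : ℝ => p.eval t * (1 - t ^ 2) ^ α) (Icc a 1) := by
  have hmem : ∀ t ∈ Ioo a 1, t ∈ Icc (-1 : ℝ) 1 := fun t ht => ⟨by linarith [ht.1], ht.2.le⟩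
  refine antitoneOn_of_deriv_nonpos (convex_Icc _ _)
    (continuous_eval_mul_weight (by linarith) p).continuousOn ?_ ?_
  · intro t ht
    rw [interior_Icc] at ht
    exact (hasDerivAt_eval_mul_weight hα p (hmem t ht)).differentiableAt.differentiableWithinAt
  · intro t ht
    rw [interior_Icc] at ht
    rw [(hasDerivAt_eval_mul_weight hα p (hmem t ht)).deriv]
    exact mul_nonpos_of_nonpos_of_nonneg (hp t ht) (weight_nonneg (hmem t ht))

lemma eval_mul_weight_one (hα : 1 ≤ α) (p : ℝ[X]) : p.eval 1 * (1 - (1 : ℝ) ^ 2) ^ α = 0 := by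
  norm_num [Real.zero_rpow (by linarith : α ≠ 0)]

/-- Beyond the turning point of the ultraspherical equation the polynomial times its weight
decreases. -/
lemma antitoneOn_ultra_mul_weight (hα : 1 ≤ α) (s : ℕ) {a : ℝ} (ha : 0 ≤ a)
    (hs : (α + s * (s + 2 * α + 1)) * (1 - a ^ 2) ≤ α ^ 2 * a ^ 2) :
    AntitoneOn (fun t : ℝ => (ultra s α).eval t * (1 - t ^ 2) ^ α) (Icc a 1) := by
  have hα0 : 0 ≤ α := by linarith
  set U := ultra s α with hU
  set Φ : ℝ[X] := C α * X * U - (1 - X ^ 2) * derivative U with hΦ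
  have hode : ∀ t : ℝ, (1 - t ^ 2) * (derivative (derivative U)).eval t =
      2 * (α + 1) * t * (derivative U).eval t - s * (s + 2 * α + 1) * U.eval t := by
    intro t
    have := congrArg (eval t) (raise_derivative_ultra hα0 s)
    simp only [raise, eval_sub, eval_mul, eval_one, eval_pow, eval_X, eval_C, ← hU] at this
    linarith
  have hΦe : ∀ t : ℝ, Φ.eval t = α * t * U.eval t - (1 - t ^ 2) * (derivative U).eval t := by
    intro t
    simp [hΦ]
  have hΦd : ∀ t : ℝ, (derivative Φ).eval t =
      α * U.eval t + α * t * (derivative U).eval t + 2 * t * (derivative U).eval t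
        - (1 - t ^ 2) * (derivative (derivative U)).eval t := by
    intro t
    simp [hΦ]
    ring
  have hE : ∀ t ∈ Ioo a 1, 0 ≤ α ^ 2 * t ^ 2 - (α + s * (s + 2 * α + 1)) * (1 - t ^ 2) := by
    intro t ht
    have h1 : a ^ 2 ≤ t ^ 2 := by nlinarith [ht.1]
    have h2 : 0 ≤ α + s * (s + 2 * α + 1) := by positivity
    nlinarith [mul_le_mul_of_nonneg_left h1 h2, mul_le_mul_of_nonneg_left h1 (sq_nonneg α)]
  have hprod : AntitoneOn (fun t : ℝ => (U * Φ).eval t * (1 - t ^ 2) ^ α) (Icc a 1) := by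
    refine antitoneOn_eval_mul_weight hα _ ha fun t ht => ?_
    have h : (1 - t ^ 2) * (derivative (U * Φ)).eval t - 2 * α * t * (U * Φ).eval t =
        -(Φ.eval t ^ 2 + (α ^ 2 * t ^ 2 - (α + s * (s + 2 * α + 1)) * (1 - t ^ 2))
          * U.eval t ^ 2) := by
      simp only [derivative_mul, eval_add, eval_mul]
      rw [hΦd, hode, hΦe]
      ring
    rw [h]
    have := mul_nonneg (hE t ht) (sq_nonneg (U.eval t))
    nlinarith [sq_nonneg (Φ.eval t)]
  have hprod_nonneg : ∀ t ∈ Icc a 1, 0 ≤ (U * Φ).eval t * (1 - t ^ 2) ^ α := by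
    intro t ht
    have := hprod ht ⟨ht.1.trans ht.2, le_rfl⟩ ht.2
    simp only at this
    rwa [eval_mul_weight_one hα] at this
  have hne : ∀ t ∈ Icc a 1, U.eval t ≠ 0 := by
    intro t ht h0
    have ht1 : t < 1 := by
      refine lt_of_le_of_ne ht.2 ?_
      rintro rfl
      rw [hU, ultra_eval_one hα0] at h0
      exact one_ne_zero h0
    have hzero : U * Φ = 0 := by
      refine eq_zero_of_infinite_isRoot _ ((Ioo_infinite ht1).mono fun x hx => ?_)
      have h1 := hprod ht ⟨ht.1.trans hx.1.le, hx.2.le⟩ hx.1.le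
      have h2 := hprod_nonneg x ⟨ht.1.trans hx.1.le, hx.2.le⟩
      simp only [eval_mul, h0, zero_mul] at h1 h2
      have hw : 0 < (1 - x ^ 2) ^ α :=
        Real.rpow_pos_of_pos (by nlinarith [hx.1, hx.2, ht.1]) _
      rw [Set.mem_ofPred_eq, IsRoot, eval_mul]
      exact (mul_eq_zero.1 (le_antisymm h1 h2)).resolve_right hw.ne'
    have hev := congrArg (eval 1) hzero
    rw [eval_mul, hΦe, hU, ultra_eval_one hα0] at hev
    norm_num at hev
    linarith
  have hpos : ∀ t ∈ Icc a 1, 0 < U.eval t := by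
    intro t ht
    by_contra! hle
    obtain ⟨x, hx, hx0⟩ := intermediate_value_Icc ht.2 U.continuous.continuousOn
      ⟨hle, by rw [hU, ultra_eval_one hα0]; exact zero_le_one⟩
    exact hne x ⟨ht.1.trans hx.1, hx.2⟩ hx0
  refine antitoneOn_eval_mul_weight hα _ ha fun t ht => ?_
  have hw : 0 < (1 - t ^ 2) ^ α := Real.rpow_pos_of_pos (by nlinarith [ht.1, ht.2]) _
  have h1 := hpos t (Ioo_subset_Icc_self ht)
  have h2 := hprod_nonneg t (Ioo_subset_Icc_self ht)
  rw [eval_mul] at h2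
  have h3 : 0 ≤ Φ.eval t := nonneg_of_mul_nonneg_right (nonneg_of_mul_nonneg_left h2 hw) h1
  rw [hΦe] at h3
  have h4 : 0 ≤ α * t * U.eval t :=
    mul_nonneg (mul_nonneg hα0 (ha.trans ht.1.le)) h1.le
  linarith

end Monotonicity

section LowerBound

variable {α : ℝ}

lemma abs_integral_mul_weight_le (hα : 0 ≤ α) (p : ℝ[X]) {a b₁ b₂ r : ℝ} (ha : 0 ≤ a)
    (h₁ : a ≤ b₁) (h₁₂ : b₁ ≤ b₂) (h₂ : b₂ ≤ 1) (hr : 0 < r)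
    (hpr : (1 - a ^ 2) ^ α * weightedIntegral α (p * p) ≤ r ^ 2) (haw : 0 < (1 - a ^ 2) ^ α) :
    |∫ t in b₁..b₂, p.eval t * (1 - t ^ 2) ^ α| ≤ r := by
  set W := (1 - a ^ 2) ^ α with hW
  have hcont := continuous_eval_mul_weight hα
  have hsub : Icc b₁ b₂ ⊆ Icc (-1 : ℝ) 1 := Icc_subset_Icc (by linarith) h₂
  have hI : ∫ t in b₁..b₂, (p * p).eval t * (1 - t ^ 2) ^ α ≤ weightedIntegral α (p * p) := by
    refine intervalIntegral.integral_mono_interval (by linarith) h₁₂ h₂ ?_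
      ((hcont _).intervalIntegrable _ _)
    refine (MeasureTheory.ae_restrict_mem measurableSet_Ioc).mono fun t ht => ?_
    simp only [Pi.zero_apply, eval_mul]
    exact mul_nonneg (mul_self_nonneg _) (weight_nonneg (Ioc_subset_Icc_self ht))
  have hint : ∫ t in b₁..b₂, (1 - t ^ 2) ^ α ≤ W := by
    have h : ∫ t in b₁..b₂, (1 - t ^ 2) ^ α ≤ ∫ _ in b₁..b₂, W := by
      refine intervalIntegral.integral_mono_on h₁₂
        ((continuous_weight hα).intervalIntegrable _ _) (by simp) fun t ht => ?_
      refine Real.rpow_le_rpow (one_sub_sq_nonneg (hsub ht)) ?_ hα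
      nlinarith [ht.1]
    rw [intervalIntegral.integral_const, smul_eq_mul] at h
    nlinarith
  have habs : |∫ t in b₁..b₂, p.eval t * (1 - t ^ 2) ^ α| ≤
      ∫ t in b₁..b₂, (W / (2 * r) * ((p * p).eval t * (1 - t ^ 2) ^ α)
        + r / (2 * W) * (1 - t ^ 2) ^ α) := by
    refine (intervalIntegral.abs_integral_le_integral_abs h₁₂).trans ?_
    refine intervalIntegral.integral_mono_on h₁₂ ((hcont p).abs.intervalIntegrable _ _)
      (Continuous.intervalIntegrable (by
        have := hcont (p * p)
        have := continuous_weight hα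
        fun_prop) _ _) fun t ht => ?_
    have hw := weight_nonneg (α := α) (hsub ht)
    rw [abs_mul, abs_of_nonneg hw, eval_mul, ← mul_assoc, ← add_mul]
    refine mul_le_mul_of_nonneg_right ?_ hw
    rw [← abs_mul_abs_self (p.eval t)]
    have h := sq_nonneg (W * |p.eval t| - r)
    rw [div_mul_eq_mul_div, div_add_div _ _ (by positivity) (by positivity),
      le_div_iff₀ (by positivity)]
    nlinarith
  rw [intervalIntegral.integral_add (((hcont _).const_mul _).intervalIntegrable _ _)
    (((continuous_weight hα).const_mul _).intervalIntegrable _ _),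
    intervalIntegral.integral_const_mul, intervalIntegral.integral_const_mul] at habs
  refine habs.trans ?_
  have e1 : W / (2 * r) * ∫ t in b₁..b₂, (p * p).eval t * (1 - t ^ 2) ^ α ≤ r / 2 := by
    refine (mul_le_mul_of_nonneg_left hI (by positivity)).trans ?_
    rw [div_mul_eq_mul_div, div_le_iff₀ (by positivity)]
    linarith
  have e2 : r / (2 * W) * ∫ t in b₁..b₂, (1 - t ^ 2) ^ α ≤ r / 2 := by
    refine (mul_le_mul_of_nonneg_left hint (by positivity)).trans (le_of_eq ?_)
    field_simp
  linarith

lemma integral_weight_ge (hα : 1 ≤ α) :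
    1 / (α + 1) ≤ ∫ t in (-1 : ℝ)..0, (1 - t ^ 2) ^ α := by
  have h : ∫ t in (-1 : ℝ)..0, (t + 1) ^ α = 1 / (α + 1) := by
    rw [intervalIntegral.integral_comp_add_right (fun t : ℝ => t ^ α),
      integral_rpow (by left; linarith)]
    norm_num [Real.zero_rpow (by linarith : α + 1 ≠ 0)]
  rw [← h]
  refine intervalIntegral.integral_mono_on (by norm_num) (Continuous.intervalIntegrable ?_ _ _)
    ((continuous_weight (by linarith)).intervalIntegrable _ _) fun t ht => ?_
  · exact (by fun_prop : Continuous fun t : ℝ => t + 1).rpow_const fun _ => Or.inr (by linarith)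
  · exact Real.rpow_le_rpow (by linarith [ht.1]) (by nlinarith [ht.1, ht.2]) (by linarith)

/-- Integration against the weight over `[-1, c]`, with the part over `[a, c]` counted
`1 + 1 / (c - a)` times. -/
noncomputable def dualFunctional (α a c : ℝ) (p : ℝ[X]) : ℝ :=
  (∫ t in (-1 : ℝ)..c, p.eval t * (1 - t ^ 2) ^ α)
    + 1 / (c - a) * ∫ t in a..c, p.eval t * (1 - t ^ 2) ^ α

lemma dualFunctional_C_mul (a c x : ℝ) (p : ℝ[X]) :
    dualFunctional α a c (C x * p) = x * dualFunctional α a c p := by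
  simp only [dualFunctional, eval_mul, eval_C, mul_assoc, intervalIntegral.integral_const_mul]
  ring

lemma dualFunctional_sum (hα : 0 ≤ α) (a c : ℝ) {ι : Type*} (u : Finset ι) (p : ι → ℝ[X]) :
    dualFunctional α a c (∑ i ∈ u, p i) = ∑ i ∈ u, dualFunctional α a c (p i) := by
  simp only [dualFunctional, eval_finsetSum, Finset.sum_mul]
  rw [intervalIntegral.integral_finsetSum fun i _ =>
      (continuous_eval_mul_weight hα (p i)).intervalIntegrable _ _,
    intervalIntegral.integral_finsetSum fun i _ =>
      (continuous_eval_mul_weight hα (p i)).intervalIntegrable _ _,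
    Finset.mul_sum, Finset.sum_add_distrib]

lemma dualFunctional_nonpos {a c : ℝ} (ha : 0 ≤ a) (hac : a < c) (hc : c ≤ 1) {p : ℝ[X]}
    (hp : ∀ t ∈ Icc (-1 : ℝ) c, p.eval t ≤ 0) : dualFunctional α a c p ≤ 0 := by
  have h : ∀ b, -1 ≤ b → b ≤ c → ∫ t in b..c, p.eval t * (1 - t ^ 2) ^ α ≤ 0 := by
    intro b hb hbc
    rw [← neg_nonneg, ← intervalIntegral.integral_neg]
    refine intervalIntegral.integral_nonneg hbc fun t ht => ?_
    rw [neg_nonneg]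
    exact mul_nonpos_of_nonpos_of_nonneg (hp t ⟨hb.trans ht.1, ht.2⟩)
      (weight_nonneg ⟨hb.trans ht.1, ht.2.trans hc⟩)
  have h1 := h (-1) le_rfl (by linarith)
  have h2 := h a (by linarith) hac.le
  have h3 : 0 ≤ 1 / (c - a) := by
    have := sub_pos.2 hac
    positivity
  exact add_nonpos h1 (mul_nonpos_of_nonneg_of_nonpos h3 h2)

lemma dualFunctional_one_ge (hα : 1 ≤ α) {a c : ℝ} (ha : 0 ≤ a) (hac : a < c) (hc : c ≤ 1) :
    1 / (α + 1) ≤ dualFunctional α a c 1 := by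
  have hcont := continuous_weight (by linarith : 0 ≤ α)
  have h1 := integral_weight_ge hα
  have h2 : (∫ t in (-1 : ℝ)..0, (1 - t ^ 2) ^ α) ≤ ∫ t in (-1 : ℝ)..c, (1 - t ^ 2) ^ α := by
    refine intervalIntegral.integral_mono_interval le_rfl (by norm_num) (by linarith) ?_
      (hcont.intervalIntegrable _ _)
    refine (MeasureTheory.ae_restrict_mem measurableSet_Ioc).mono fun t ht => ?_
    exact weight_nonneg ⟨ht.1.le, ht.2.trans hc⟩
  have h3 : 0 ≤ ∫ t in a..c, (1 - t ^ 2) ^ α :=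
    intervalIntegral.integral_nonneg hac.le fun t ht =>
      weight_nonneg ⟨by linarith [ht.1], ht.2.trans hc⟩
  have h4 : 0 ≤ 1 / (c - a) := by
    have := sub_pos.2 hac
    positivity
  simp only [dualFunctional, eval_one, one_mul]
  nlinarith [mul_nonneg h4 h3]

lemma integral_ultra_succ (hα : 0 ≤ α) (s : ℕ) (c : ℝ) :
    (∫ t in (-1 : ℝ)..c, (ultra (s + 1) α).eval t * (1 - t ^ 2) ^ α) =
      -∫ t in c..1, (ultra (s + 1) α).eval t * (1 - t ^ 2) ^ α := by
  have hcont := continuous_eval_mul_weight hα (ultra (s + 1) α)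
  have h := weightedIntegral_ultra_mul_eq_zero hα (s := s + 1) (p := 1)
    (by rw [degree_one]; exact_mod_cast Nat.succ_pos s)
  rw [mul_one, weightedIntegral, ← intervalIntegral.integral_add_adjacent_intervals
    (hcont.intervalIntegrable _ c) (hcont.intervalIntegrable c _)] at h
  linarith

lemma dualFunctional_ultra_nonneg (hα : 1 ≤ α) (s : ℕ) {a c : ℝ} (ha : 0 ≤ a) (hac : a < c)
    (hc : c ≤ 1)
    (hs : (α + (s + 1 : ℕ) * ((s + 1 : ℕ) + 2 * α + 1)) * (1 - a ^ 2) ≤ α ^ 2 * a ^ 2) :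
    0 ≤ dualFunctional α a c (ultra (s + 1) α) := by
  have hcont := continuous_eval_mul_weight (by linarith : 0 ≤ α) (ultra (s + 1) α)
  have hanti := antitoneOn_ultra_mul_weight hα (s + 1) ha hs
  set f : ℝ → ℝ := fun t => (ultra (s + 1) α).eval t * (1 - t ^ 2) ^ α with hf
  have hfc : 0 ≤ f c := by
    have := hanti ⟨hac.le, hc⟩ ⟨hac.le.trans hc, le_rfl⟩ hc
    simp only [hf] at this ⊢
    rwa [eval_mul_weight_one hα] at this
  have h1 : ∫ t in c..1, f t ≤ f c := by
    have h : ∫ t in c..1, f t ≤ ∫ _ in c..1, f c :=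
      intervalIntegral.integral_mono_on hc (hcont.intervalIntegrable _ _) (by simp)
        fun t ht => hanti ⟨hac.le, hc⟩ ⟨hac.le.trans ht.1, ht.2⟩ ht.1
    rw [intervalIntegral.integral_const, smul_eq_mul] at h
    nlinarith
  have h2 : (c - a) * f c ≤ ∫ t in a..c, f t := by
    have h : ∫ _ in a..c, f c ≤ ∫ t in a..c, f t :=
      intervalIntegral.integral_mono_on hac.le (by simp) (hcont.intervalIntegrable _ _)
        fun t ht => hanti ⟨ht.1, ht.2.trans hc⟩ ⟨hac.le, hc⟩ ht.2
    rwa [intervalIntegral.integral_const, smul_eq_mul] at h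
  have hca := sub_pos.2 hac
  have h3 : f c ≤ 1 / (c - a) * ∫ t in a..c, f t := by
    rw [one_div_mul_eq_div, le_div_iff₀ hca]
    linarith
  rw [dualFunctional, integral_ultra_succ (by linarith)]
  linarith

lemma dualFunctional_ultra_ge (hα : 0 ≤ α) (s : ℕ) {a c r : ℝ} (ha : 0 ≤ a) (hac : a < c)
    (hc : c < 1) (hr : 0 < r)
    (hs : (1 - a ^ 2) ^ α * weightedIntegral α (ultra (s + 1) α * ultra (s + 1) α) ≤ r ^ 2) :
    -((1 + 1 / (c - a)) * r) ≤ dualFunctional α a c (ultra (s + 1) α) := by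
  have hw : 0 < (1 - a ^ 2) ^ α := Real.rpow_pos_of_pos (by nlinarith) _
  have h1 := abs_integral_mul_weight_le hα _ ha hac.le hc.le le_rfl hr hs hw
  have h2 := abs_integral_mul_weight_le hα _ ha le_rfl hac.le hc.le hr hs hw
  have hca : 0 ≤ 1 / (c - a) := by
    have := sub_pos.2 hac
    positivity
  rw [dualFunctional, integral_ultra_succ hα]
  nlinarith [(abs_le.1 h1).2, mul_le_mul_of_nonneg_left (abs_le.1 h2).1 hca]

lemma eval_one_ge_of_feasible (hα : 1 ≤ α) {a c r : ℝ} (ha : 0 ≤ a) (hac : a < c) (hc : c < 1)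
    (hr : 0 < r)
    (hs : ∀ s : ℕ, (α + s * (s + 2 * α + 1)) * (1 - a ^ 2) ≤ α ^ 2 * a ^ 2 ∨
      (1 - a ^ 2) ^ α * weightedIntegral α (ultra s α * ultra s α) ≤ r ^ 2)
    {F : ℝ[X]} {m : ℕ} {b : ℕ → ℝ} (hF : F = ∑ s ∈ Finset.range (m + 1), C (b s) * ultra s α)
    (hb : ∀ s, 0 ≤ b s) (hb0 : b 0 = 1) (hFc : ∀ t ∈ Icc (-1 : ℝ) c, F.eval t ≤ 0) :
    1 / ((α + 1) * ((1 + 1 / (c - a)) * r)) ≤ F.eval 1 := by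
  have hα0 : 0 ≤ α := by linarith
  have hca := sub_pos.2 hac
  set R := (1 + 1 / (c - a)) * r with hR
  have hRpos : 0 < R := by positivity
  have hone : F.eval 1 = ∑ s ∈ Finset.range m, b (s + 1) + 1 := by
    rw [hF, Finset.sum_range_succ', eval_add, eval_finsetSum]
    simp [ultra_eval_one hα0, hb0]
  have h1 := dualFunctional_nonpos (α := α) ha hac hc.le hFc
  rw [hF, dualFunctional_sum hα0, Finset.sum_range_succ'] at h1
  simp only [dualFunctional_C_mul, hb0, one_mul] at h1
  have h2 : 1 / (α + 1) ≤ dualFunctional α a c (ultra 0 α) := dualFunctional_one_ge hα ha hac hc.le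
  have h3 : -(R * ∑ s ∈ Finset.range m, b (s + 1)) ≤
      ∑ s ∈ Finset.range m, b (s + 1) * dualFunctional α a c (ultra (s + 1) α) := by
    rw [Finset.mul_sum, ← Finset.sum_neg_distrib]
    refine Finset.sum_le_sum fun s _ => ?_
    have : -R ≤ dualFunctional α a c (ultra (s + 1) α) := by
      rcases hs (s + 1) with h | h
      · linarith [dualFunctional_ultra_nonneg hα s ha hac hc.le h]
      · exact dualFunctional_ultra_ge hα0 s ha hac hc hr h
    nlinarith [mul_le_mul_of_nonneg_left this (hb (s + 1))]
  rw [hone, ← div_div, div_le_iff₀ hRpos]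
  nlinarith

end LowerBound

section Feasibility

variable {α : ℝ}

lemma exists_eq_sum_ultra (hα : 0 ≤ α) (m : ℕ) (p : ℝ[X]) (hp : p.natDegree ≤ m) :
    ∃ b : ℕ → ℝ, p = ∑ s ∈ Finset.range (m + 1), C (b s) * ultra s α := by
  induction m generalizing p with
  | zero =>
    refine ⟨fun _ => p.coeff 0, ?_⟩
    rw [Finset.sum_range_one, ultra, mul_one]
    exact eq_C_of_natDegree_le_zero hp
  | succ m ih =>
    have hu := coeff_ultra_pos hα (m + 1)
    set x := p.coeff (m + 1) / (ultra (m + 1) α).coeff (m + 1) with hx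
    have hdeg : (p - C x * ultra (m + 1) α).natDegree ≤ m := by
      rw [natDegree_le_iff_coeff_eq_zero]
      intro N hN
      rw [coeff_sub, coeff_C_mul]
      rcases (Nat.succ_le_of_lt hN).eq_or_lt with rfl | h
      · rw [hx]
        field_simp
        ring
      · rw [coeff_eq_zero_of_natDegree_lt (by omega),
          coeff_eq_zero_of_natDegree_lt ((natDegree_ultra_le _).trans_lt h)]
        ring
    obtain ⟨b, hb⟩ := ih _ hdeg
    refine ⟨Function.update b (m + 1) x, ?_⟩
    rw [Finset.sum_range_succ, Function.update_self, ← sub_eq_iff_eq_add, hb]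
    refine Finset.sum_congr rfl fun s hs => ?_
    rw [Function.update_of_ne (Finset.mem_range.1 hs).ne]

lemma weightedIntegral_ultra_mul_ultra (hα : 0 ≤ α) {s j : ℕ} (h : s ≠ j) :
    weightedIntegral α (ultra s α * ultra j α) = 0 := by
  have hdeg : ∀ i, (ultra i α).degree ≤ i := fun i =>
    natDegree_le_iff_degree_le.1 (natDegree_ultra_le i)
  rcases h.lt_or_gt with h | h
  · rw [mul_comm]
    exact weightedIntegral_ultra_mul_eq_zero hα ((hdeg s).trans_lt (by exact_mod_cast h))
  · exact weightedIntegral_ultra_mul_eq_zero hα ((hdeg j).trans_lt (by exact_mod_cast h))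

lemma weightedIntegral_ultra_mul_sum (hα : 0 ≤ α) (m : ℕ) (b : ℕ → ℝ) {s : ℕ} (hs : s ≤ m) :
    weightedIntegral α (ultra s α * ∑ j ∈ Finset.range (m + 1), C (b j) * ultra j α) =
      b s * weightedIntegral α (ultra s α * ultra s α) := by
  rw [Finset.mul_sum, weightedIntegral_sum hα, Finset.sum_eq_single s]
  · rw [mul_left_comm, weightedIntegral_C_mul]
  · intro j _ hj
    rw [mul_left_comm, weightedIntegral_C_mul, weightedIntegral_ultra_mul_ultra hα hj.symm,
      mul_zero]
  · intro h
    exact absurd (Finset.mem_range.2 (by omega)) h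

lemma exists_pow_mul_lt_weightedIntegral (hα : 0 ≤ α) {c : ℝ} (hc0 : 0 ≤ c) (hc1 : c < 1) :
    ∃ N : ℕ, (1 + c) ^ N * weightedIntegral α 1 < weightedIntegral α ((1 + X) ^ N) := by
  set d := (1 + c) / 2 with hd
  have hd1 : d < 1 := by rw [hd]; linarith
  have hcd : c < d := by rw [hd]; linarith
  have hcont := continuous_weight hα
  set μ := ∫ t in d..1, (1 - t ^ 2) ^ α with hμ
  have hμpos : 0 < μ := by
    refine intervalIntegral.intervalIntegral_pos_of_pos_on (hcont.intervalIntegrable _ _)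
      (fun t ht => Real.rpow_pos_of_pos ?_ _) hd1
    nlinarith [ht.1, ht.2]
  obtain ⟨N, hN⟩ := pow_unbounded_of_one_lt (weightedIntegral α 1 / μ)
    (show 1 < (1 + d) / (1 + c) by rw [one_lt_div (by linarith)]; linarith)
  refine ⟨N, ?_⟩
  have h1 : (1 + d) ^ N * μ ≤ weightedIntegral α ((1 + X) ^ N) := by
    have h2 : (1 + d) ^ N * μ ≤ ∫ t in d..1, ((1 + X) ^ N : ℝ[X]).eval t * (1 - t ^ 2) ^ α := by
      rw [hμ, ← intervalIntegral.integral_const_mul]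
      refine intervalIntegral.integral_mono_on hd1.le ((hcont.const_mul _).intervalIntegrable _ _)
        ((continuous_eval_mul_weight hα _).intervalIntegrable _ _) fun t ht => ?_
      simp only [eval_pow, eval_add, eval_one, eval_X]
      exact mul_le_mul_of_nonneg_right (pow_le_pow_left₀ (by linarith) (by linarith [ht.1]) _)
        (weight_nonneg ⟨by linarith [ht.1], ht.2⟩)
    refine h2.trans (intervalIntegral.integral_mono_interval (by linarith) hd1.le le_rfl ?_
      ((continuous_eval_mul_weight hα _).intervalIntegrable _ _))
    refine (MeasureTheory.ae_restrict_mem measurableSet_Ioc).mono fun t ht => ?_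
    simp only [Pi.zero_apply, eval_pow, eval_add, eval_one, eval_X]
    exact mul_nonneg (pow_nonneg (by linarith [ht.1]) _) (weight_nonneg (Ioc_subset_Icc_self ht))
  refine lt_of_lt_of_le ?_ h1
  rw [div_pow, div_lt_div_iff₀ hμpos (by positivity)] at hN
  linarith

lemma exists_feasible (hα : 0 ≤ α) {c : ℝ} (hc0 : 0 ≤ c) (hc1 : c < 1) :
    ∃ (m : ℕ) (b : ℕ → ℝ), (∀ s, 0 ≤ b s) ∧ b 0 = 1 ∧
      ∀ t ∈ Icc (-1 : ℝ) c, (∑ s ∈ Finset.range (m + 1), C (b s) * ultra s α).eval t ≤ 0 := by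
  obtain ⟨N, hN⟩ := exists_pow_mul_lt_weightedIntegral hα hc0 hc1
  obtain ⟨b, hb⟩ := exists_eq_sum_ultra hα N ((1 + X) ^ N) (by compute_degree)
  have hcoef : ∀ s ≤ N, weightedIntegral α (ultra s α * (1 + X) ^ N) =
      b s * weightedIntegral α (ultra s α * ultra s α) := by
    intro s hs
    rw [← weightedIntegral_ultra_mul_sum hα N b hs, ← hb]
  have hpos : ∀ s ≤ N, 0 ≤ b s := fun s hs =>
    nonneg_of_mul_nonneg_left
      (by rw [← hcoef s hs]; exact weightedIntegral_ultra_mul_pow_nonneg hα s N)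
      (weightedIntegral_sq_pos hα (ultra_ne_zero hα s))
  have hb0 : 0 < b 0 - (1 + c) ^ N := by
    have h := hcoef 0 (Nat.zero_le _)
    simp only [ultra, one_mul] at h
    rw [h] at hN
    have h1 : 0 < weightedIntegral α 1 := by
      simpa using weightedIntegral_sq_pos hα (one_ne_zero : (1 : ℝ[X]) ≠ 0)
    exact sub_pos.2 (lt_of_mul_lt_mul_right hN h1.le)
  set x := b 0 - (1 + c) ^ N with hx
  refine ⟨N, fun s => if s = 0 then 1 else if s ≤ N then b s / x else 0, ?_, by simp, ?_⟩
  · intro s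
    by_cases h0 : s = 0
    · simp [h0]
    · by_cases h : s ≤ N
      · simpa [h0, h] using div_nonneg (hpos s h) hb0.le
      · simp [h0, h]
  · intro t ht
    have hev := congrArg (eval t) hb
    rw [Finset.sum_range_succ'] at hev ⊢
    simp only [eval_pow, eval_add, eval_one, eval_X, eval_finsetSum, eval_mul, eval_C, ultra,
      mul_one] at hev ⊢
    have hsum : ∑ s ∈ Finset.range N, (if s + 1 = 0 then 1 else if s + 1 ≤ N then b (s + 1) / x
        else 0) * (ultra (s + 1) α).eval t =
        (∑ s ∈ Finset.range N, b (s + 1) * (ultra (s + 1) α).eval t) / x := by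
      rw [Finset.sum_div]
      refine Finset.sum_congr rfl fun s hs => ?_
      rw [if_neg (Nat.succ_ne_zero s), if_pos (Nat.succ_le_of_lt (Finset.mem_range.1 hs))]
      ring
    simp only [ultra, eval_mul, eval_C] at hsum
    rw [hsum, if_pos trivial, div_add_one hb0.ne']
    refine div_nonpos_of_nonpos_of_nonneg ?_ hb0.le
    have : (1 + t) ^ N ≤ (1 + c) ^ N :=
      pow_le_pow_left₀ (by linarith [ht.1]) (by linarith [ht.2]) _
    linarith

end Feasibility

section Norms

variable {α : ℝ}

lemma weightedIntegral_one_le (hα : 0 ≤ α) : weightedIntegral α 1 ≤ 2 := by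
  have h : weightedIntegral α 1 ≤ ∫ _ in (-1 : ℝ)..1, (1 : ℝ) := by
    refine intervalIntegral.integral_mono_on (by norm_num)
      ((continuous_eval_mul_weight hα _).intervalIntegrable _ _) (by simp) fun t ht => ?_
    rw [eval_one, one_mul]
    exact Real.rpow_le_one (one_sub_sq_nonneg ht) (by nlinarith [sq_nonneg t]) hα
  rw [intervalIntegral.integral_const, smul_eq_mul] at h
  linarith

lemma weightedIntegral_ultra_sq_le (hα : 0 ≤ α) {k s : ℕ} (hks : k ≤ s) :
    weightedIntegral α (ultra s α * ultra s α) ≤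
      2 / ∏ i ∈ Finset.range k, (1 + (2 * α + 1) / ((i : ℝ) + 1)) := by
  have hterm : ∀ i : ℕ, 1 ≤ 1 + (2 * α + 1) / ((i : ℝ) + 1) := fun i => by
    have : 0 ≤ (2 * α + 1) / ((i : ℝ) + 1) := by positivity
    linarith
  have hpos : ∀ j : ℕ, 0 < ∏ i ∈ Finset.range j, (1 + (2 * α + 1) / ((i : ℝ) + 1)) := fun j =>
    Finset.prod_pos fun i _ => zero_lt_one.trans_le (hterm i)
  rw [weightedIntegral_ultra_sq hα]
  refine div_le_div₀ zero_le_two ?_ (hpos k) ?_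
  · refine (mul_le_of_le_one_right ?_ ?_).trans (weightedIntegral_one_le hα)
    · exact weightedIntegral_nonneg fun t _ => by simp
    · rw [div_le_one (by positivity)]
      have : (0 : ℝ) ≤ s := by positivity
      linarith
  · refine monotone_nat_of_le_succ (f := fun j => ∏ i ∈ Finset.range j,
      (1 + (2 * α + 1) / ((i : ℝ) + 1))) (fun j => ?_) hks
    simp only [Finset.prod_range_succ]
    exact le_mul_of_one_le_right (hpos j).le (hterm j)

end Norms

section Entropy

/-- The exponent of the binomial coefficients `(x * m + m).choose m`. -/
noncomputable def binomialExponent (x : ℝ) : ℝ := (1 + x) * Real.log (1 + x) - x * Real.log x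

lemma hasDerivAt_add_mul_log_sub {m x : ℝ} (hm : 0 ≤ m) (hx : 0 < x) :
    HasDerivAt (fun x => (x + m) * Real.log (x + m) - x * Real.log x)
      (Real.log (x + m) - Real.log x) x := by
  have h2 := Real.hasDerivAt_mul_log hx.ne'
  refine ((Real.hasDerivAt_mul_log (by positivity : x + m ≠ 0)).comp_add_const x m |>.sub
    h2).congr_deriv ?_
  ring

lemma add_mul_log_sub_succ_le {m x : ℝ} (hm : 0 ≤ m) (hx : 0 < x) :
    ((x + 1 + m) * Real.log (x + 1 + m) - (x + 1) * Real.log (x + 1)) -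
      ((x + m) * Real.log (x + m) - x * Real.log x) ≤ Real.log (1 + m / x) := by
  have hd : ∀ y : ℝ, x ≤ y → HasDerivAt (fun x => (x + m) * Real.log (x + m) - x * Real.log x)
      (Real.log (y + m) - Real.log y) y := fun y hy =>
    hasDerivAt_add_mul_log_sub hm (hx.trans_le hy)
  obtain ⟨y, hy, hyd⟩ := exists_hasDerivAt_eq_slope
    (fun x => (x + m) * Real.log (x + m) - x * Real.log x)
    (fun y => Real.log (y + m) - Real.log y) (lt_add_one x)
    (fun y hy => (hd y hy.1).continuousAt.continuousWithinAt) (fun y hy => hd y hy.1.le)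
  rw [add_sub_cancel_left, div_one] at hyd
  rw [← hyd]
  have hy0 : 0 < y := hx.trans hy.1
  rw [← Real.log_div (by positivity) hy0.ne']
  refine Real.log_le_log (by positivity) ?_
  rw [add_div, div_self hy0.ne']
  have := div_le_div_of_nonneg_left hm hx hy.1.le
  linarith

lemma le_log_prod_one_add_div {m : ℝ} (hm : 0 ≤ m) (k : ℕ) :
    ((k + 1 + m) * Real.log (k + 1 + m) - (k + 1) * Real.log (k + 1)) -
      (1 + m) * Real.log (1 + m) ≤
      Real.log (∏ i ∈ Finset.range k, (1 + m / ((i : ℝ) + 1))) := by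
  induction k with
  | zero => simp
  | succ k ih =>
    have hpos : ∀ i : ℕ, 0 < 1 + m / ((i : ℝ) + 1) := fun i => by positivity
    rw [Finset.prod_range_succ, Real.log_mul (Finset.prod_pos fun i _ => hpos i).ne' (hpos k).ne']
    have := add_mul_log_sub_succ_le hm (by positivity : (0 : ℝ) < k + 1)
    push_cast
    linarith

lemma monotoneOn_add_mul_log_sub {m : ℝ} (hm : 0 ≤ m) :
    MonotoneOn (fun x => (x + m) * Real.log (x + m) - x * Real.log x) (Ioi 0) := by
  refine monotoneOn_of_deriv_nonneg (convex_Ioi _)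
    (fun x hx => (hasDerivAt_add_mul_log_sub hm hx).continuousAt.continuousWithinAt)
    (fun x hx => ?_) (fun x hx => ?_)
  · rw [interior_Ioi] at hx
    exact (hasDerivAt_add_mul_log_sub hm hx).differentiableAt.differentiableWithinAt
  · rw [interior_Ioi] at hx
    rw [(hasDerivAt_add_mul_log_sub hm hx).deriv, sub_nonneg]
    exact Real.log_le_log hx (by linarith)

lemma binomialExponent_le_log_prod {m κ : ℝ} (hm : 1 ≤ m) (hκ : 0 < κ) {k : ℕ} (hk : κ * m ≤ k) :
    m * binomialExponent κ - Real.log (1 + m) - 1 ≤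
      Real.log (∏ i ∈ Finset.range k, (1 + m / ((i : ℝ) + 1))) := by
  have hm0 : 0 < m := by linarith
  refine le_trans ?_ (le_log_prod_one_add_div hm0.le k)
  have h := monotoneOn_add_mul_log_sub hm0.le (mul_pos hκ hm0)
    (show (k : ℝ) + 1 ∈ Ioi (0 : ℝ) by rw [mem_Ioi]; positivity) (by linarith : κ * m ≤ k + 1)
  simp only at h
  rw [show κ * m + m = (1 + κ) * m by ring, Real.log_mul (by positivity) hm0.ne',
    Real.log_mul hκ.ne' hm0.ne'] at h
  have h1 : m * (Real.log (1 + m) - Real.log m) ≤ 1 := by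
    rw [← Real.log_div (by positivity) hm0.ne']
    have h2 := Real.log_le_sub_one_of_pos (show 0 < (1 + m) / m by positivity)
    have h3 : m * ((1 + m) / m - 1) = 1 := by
      field_simp
      ring
    exact (mul_le_mul_of_nonneg_left h2 hm0.le).trans_eq h3
  unfold binomialExponent
  linarith

end Entropy

section Asymptotics

open Filter Topology

lemma le_MLP {α θ : ℝ} (hα : 1 ≤ α) {a r : ℝ} (ha : 0 ≤ a) (hac : a < Real.cos θ)
    (hc : Real.cos θ < 1) (hr : 0 < r)
    (hs : ∀ s : ℕ, (α + s * (s + 2 * α + 1)) * (1 - a ^ 2) ≤ α ^ 2 * a ^ 2 ∨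
      (1 - a ^ 2) ^ α * weightedIntegral α (ultra s α * ultra s α) ≤ r ^ 2)
    {P : ℕ → ℝ[X]} (hP : ∀ s, IsJacobi α s (P s)) :
    1 / ((α + 1) * ((1 + 1 / (Real.cos θ - a)) * r)) ≤ MLP θ P := by
  have hα0 : 0 ≤ α := by linarith
  have hpos := fun s => (hP s).eval_one_pos hα0
  have hPu := fun s => (hP s).eq_C_mul_ultra hα0
  refine le_csInf ?_ ?_
  · obtain ⟨m, b, hb, hb0, hneg⟩ := exists_feasible hα0 (ha.trans hac.le) hc
    refine ⟨_, m, fun s => b s / (P s).eval 1, ∑ s ∈ Finset.range (m + 1), C (b s) * ultra s α,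
      Finset.sum_congr rfl fun s _ => ?_, fun s => div_nonneg (hb s) (hpos s).le, ?_, hneg, rfl⟩
    · simp only
      conv_rhs => rw [hPu s]
      rw [← mul_assoc, ← C_mul, eval_mul, eval_C, ultra_eval_one hα0, mul_one,
        div_mul_cancel₀ _ (hpos s).ne']
    · simp only [hb0, (hP 0).eval_one_zero hα0, div_one]
  · rintro y ⟨m, b, F, hF, hb, hb0, hneg, rfl⟩
    refine eval_one_ge_of_feasible hα ha hac hc hr hs (b := fun s => b s * (P s).eval 1) (m := m) ?_
      (fun s => mul_nonneg (hb s) (hpos s).le) ?_ hneg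
    · rw [hF]
      refine Finset.sum_congr rfl fun s _ => ?_
      rw [C_mul, mul_assoc, ← hPu s]
    · simp only [hb0, (hP 0).eval_one_zero hα0, one_mul]

/-- The limiting exponent as a function of `σ = sin θ`. -/
noncomputable def lpExponent (σ : ℝ) : ℝ :=
  1 / 2 * Real.log (1 / σ) + 1 / 2 * binomialExponent ((1 - σ) / (2 * σ))

lemma lpExponent_eq {σ : ℝ} (hσ : 0 < σ) :
    lpExponent σ = (1 / 2) * Real.log (1 / σ) +
        (1 / 2) * (((1 + σ) / (2 * σ)) * Real.log ((1 + σ) / (2 * σ)) -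
          ((1 - σ) / (2 * σ)) * Real.log ((1 - σ) / (2 * σ))) := by
  have h : 1 + (1 - σ) / (2 * σ) = (1 + σ) / (2 * σ) := by
    field_simp
    ring
  rw [lpExponent, binomialExponent, h]

lemma continuousAt_lpExponent {σ : ℝ} (hσ : 0 < σ) (hσ1 : σ < 1) : ContinuousAt lpExponent σ := by
  have h1 : ContinuousAt (fun σ : ℝ => (1 - σ) / (2 * σ)) σ := by
    refine ContinuousAt.div (by fun_prop) (by fun_prop) (by positivity)
  have hpos : 0 < (1 - σ) / (2 * σ) := div_pos (by linarith) (by linarith)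
  have h2 : ContinuousAt (fun σ : ℝ => 1 / σ) σ :=
    ContinuousAt.div (by fun_prop) (by fun_prop) hσ.ne'
  have h3 := h2.log (by positivity)
  have h4 := h1.log hpos.ne'
  have h5 := (h1.const_add 1).log (by positivity)
  have h6 : lpExponent = fun σ => 1 / 2 * Real.log (1 / σ) +
      1 / 2 * ((1 + (1 - σ) / (2 * σ)) * Real.log (1 + (1 - σ) / (2 * σ)) -
        (1 - σ) / (2 * σ) * Real.log ((1 - σ) / (2 * σ))) := rfl
  rw [h6]
  exact (h3.const_mul _).add ((((h1.const_add 1).mul h5).sub (h1.mul h4)).const_mul _)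

lemma exists_lpExponent_gt {σ₀ ε : ℝ} (h0 : 0 < σ₀) (h1 : σ₀ < 1) (hε : 0 < ε) :
    ∃ σ, σ₀ < σ ∧ σ < 1 ∧ lpExponent σ₀ - ε < lpExponent σ := by
  have hc : ∀ᶠ σ in 𝓝[>] σ₀, lpExponent σ₀ - ε < lpExponent σ :=
    ((continuousAt_lpExponent h0 h1).eventually (lt_mem_nhds (by linarith))).filter_mono
      nhdsWithin_le_nhds
  obtain ⟨σ, hσ, hσ'⟩ := (hc.and (Ioo_mem_nhdsGT h1)).exists
  exact ⟨σ, hσ'.1, hσ'.2, hσ⟩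

lemma turning_point_condition {σ κ m : ℝ} (hκ : 0 < κ) (hm : 0 ≤ m)
    (hδ : 1 + σ ^ 2 ≤ 2 * m * ((1 - σ ^ 2) / 4 - (κ ^ 2 + κ) * σ ^ 2)) {s : ℕ} (hs : s ≤ κ * m) :
    ((m - 1) / 2 + s * (s + 2 * ((m - 1) / 2) + 1)) * σ ^ 2 ≤
      ((m - 1) / 2) ^ 2 * (1 - σ ^ 2) := by
  have hs0 : (0 : ℝ) ≤ s := by positivity
  have h1 : (s : ℝ) * (s + m) ≤ (κ ^ 2 + κ) * m ^ 2 := by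
    have := mul_le_mul hs (by linarith : (s : ℝ) + m ≤ κ * m + m) (by positivity) (by positivity)
    linarith
  have h2 := mul_le_mul_of_nonneg_right h1 (sq_nonneg σ)
  have h3 := mul_le_mul_of_nonneg_left hδ hm
  nlinarith [sq_nonneg σ]

lemma turning_point_gap_pos {σ σ₁ : ℝ} (hσ : 0 < σ) (hσσ₁ : σ < σ₁) :
    0 < (1 - σ ^ 2) / 4 - (((1 - σ₁) / (2 * σ₁)) ^ 2 + (1 - σ₁) / (2 * σ₁)) * σ ^ 2 := by
  have hσ₁ : 0 < σ₁ := hσ.trans hσσ₁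
  have h : (1 - σ ^ 2) / 4 - (((1 - σ₁) / (2 * σ₁)) ^ 2 + (1 - σ₁) / (2 * σ₁)) * σ ^ 2 =
      (σ₁ ^ 2 - σ ^ 2) / (4 * σ₁ ^ 2) := by
    field_simp
    ring
  rw [h]
  exact div_pos (by nlinarith) (by positivity)

lemma log_MLP_ge {θ σ κ m : ℝ} (hm : 3 ≤ m) (hσ : 0 < σ) (hσ1 : σ < 1) (hκ : 0 < κ)
    (hθ : 0 < Real.cos θ) (hθ1 : Real.cos θ < 1) (hσθ : 1 - σ ^ 2 < Real.cos θ ^ 2)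
    (hδ : 1 + σ ^ 2 ≤ 2 * m * ((1 - σ ^ 2) / 4 - (κ ^ 2 + κ) * σ ^ 2))
    {P : ℕ → ℝ[X]} (hP : ∀ s, IsJacobi ((m - 1) / 2) s (P s)) :
    (m - 1) / 2 * Real.log (1 / σ) + m / 2 * binomialExponent κ - 3 / 2 * Real.log (1 + m)
      - Real.log (1 + 1 / (Real.cos θ - √(1 - σ ^ 2))) - 1 ≤ Real.log (MLP θ P) := by
  have ha2 : √(1 - σ ^ 2) ^ 2 = 1 - σ ^ 2 := Real.sq_sqrt (by nlinarith)
  have hac : √(1 - σ ^ 2) < Real.cos θ := (Real.sqrt_lt' hθ).2 hσθ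
  have hca := sub_pos.2 hac
  have hα : 1 ≤ (m - 1) / 2 := by linarith
  set ρ : ℝ := ((m - 1) * Real.log σ + 1 - m * binomialExponent κ + Real.log (1 + m) + 1) / 2
    with hρ
  have hL := le_MLP hα (Real.sqrt_nonneg _) hac hθ1 (Real.exp_pos ρ) (fun s => ?_) hP
  · refine le_trans ?_ (Real.log_le_log (by positivity) hL)
    have hm0 : (m - 1) / 2 + 1 ≠ 0 := (by linarith : (0 : ℝ) < (m - 1) / 2 + 1).ne'
    rw [one_div σ, Real.log_inv σ, one_div (((m - 1) / 2 + 1) * _), Real.log_inv,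
      Real.log_mul hm0 (by positivity), Real.log_mul (by positivity) (by positivity),
      Real.log_exp, hρ]
    have h1 : Real.log ((m - 1) / 2 + 1) ≤ Real.log (1 + m) :=
      Real.log_le_log (by linarith) (by linarith)
    linarith
  · rw [ha2, sub_sub_cancel]
    rcases lt_or_ge s ⌈κ * m⌉₊ with h | h
    · exact Or.inl (turning_point_condition hκ (by linarith) hδ (Nat.lt_ceil.1 h).le)
    · refine Or.inr ?_
      have hI := weightedIntegral_ultra_sq_le (by linarith : 0 ≤ (m - 1) / 2) h
      rw [show 2 * ((m - 1) / 2) + 1 = m by ring] at hI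
      have hD := binomialExponent_le_log_prod (by linarith : 1 ≤ m) hκ (Nat.le_ceil (κ * m))
      set D := ∏ i ∈ Finset.range ⌈κ * m⌉₊, (1 + m / ((i : ℝ) + 1)) with hDdef
      have hDpos : 0 < D := Finset.prod_pos fun i _ => by positivity
      have hσW : (σ ^ 2) ^ ((m - 1) / 2) = Real.exp ((m - 1) * Real.log σ) := by
        rw [Real.rpow_def_of_pos (by positivity), Real.log_pow]
        congr 1
        push_cast
        ring
      have h2D : 2 / D ≤ Real.exp (1 - Real.log D) := by
        rw [Real.exp_sub, Real.exp_log hDpos]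
        have := Real.add_one_le_exp (1 : ℝ)
        gcongr
        linarith
      rw [hσW]
      calc _ ≤ Real.exp ((m - 1) * Real.log σ) * Real.exp (1 - Real.log D) :=
            mul_le_mul_of_nonneg_left (hI.trans h2D) (Real.exp_pos _).le
        _ ≤ Real.exp ρ ^ 2 := by
            rw [← Real.exp_add, ← Real.exp_nat_mul, Real.exp_le_exp, hρ]
            push_cast
            linarith

lemma eventually_mul_log_add_le (A K : ℝ) {ε : ℝ} (hε : 0 < ε) :
    ∀ᶠ x : ℝ in atTop, A * Real.log x + K ≤ ε * x := by
  have h1 : (fun x : ℝ => A * Real.log x + K) =o[atTop] (id : ℝ → ℝ) :=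
    (Real.isLittleO_log_id_atTop.const_mul_left A).add
      (Asymptotics.isLittleO_const_id_atTop K)
  filter_upwards [h1.bound hε, eventually_ge_atTop 0] with x hx hx0
  rw [id, Real.norm_of_nonneg hx0] at hx
  exact (le_abs_self _).trans hx

end Asymptotics

/-- Corollary 1.3: for fixed `θ ∈ (0, π/2)`, as `n → ∞`,
`(1/n) log M_LP(n,θ)` is at least the average of `log(1/sin θ)` and the
Kabatyansky–Levenshtein exponent, up to `o(1)`. -/
theorem lp_code_asymptotic (θ : ℝ) (hθ : θ ∈ Set.Ioo 0 (Real.pi / 2))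
    (ε : ℝ) (hε : 0 < ε) :
    ∃ N : ℕ, ∀ n : ℕ, N ≤ n →
      ∀ P : ℕ → Polynomial ℝ, (∀ s, IsJacobi (((n : ℝ) - 3) / 2) s (P s)) →
      (1 / (n : ℝ)) * Real.log (MLP θ P) ≥
        (1 / 2) * Real.log (1 / Real.sin θ) +
        (1 / 2) * (((1 + Real.sin θ) / (2 * Real.sin θ)) *
            Real.log ((1 + Real.sin θ) / (2 * Real.sin θ)) -
          ((1 - Real.sin θ) / (2 * Real.sin θ)) *
            Real.log ((1 - Real.sin θ) / (2 * Real.sin θ))) - ε := by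
  have hcos : 0 < Real.cos θ := Real.cos_pos_of_mem_Ioo ⟨by linarith [hθ.1, Real.pi_pos], hθ.2⟩
  have hsin : 0 < Real.sin θ := Real.sin_pos_of_pos_of_lt_pi hθ.1 (by linarith [hθ.2, Real.pi_pos])
  have hsc := Real.sin_sq_add_cos_sq θ
  have hsin1 : Real.sin θ < 1 := by nlinarith
  have hcos1 : Real.cos θ < 1 := by nlinarith
  obtain ⟨σ₁, h01, h11, hexp⟩ := exists_lpExponent_gt hsin hsin1 (half_pos hε)
  set σ := (Real.sin θ + σ₁) / 2 with hσ
  have hσ0 : Real.sin θ < σ := by rw [hσ]; linarith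
  have hσσ₁ : σ < σ₁ := by rw [hσ]; linarith
  have hσpos : 0 < σ := hsin.trans hσ0
  set κ := (1 - σ₁) / (2 * σ₁) with hκ
  have hκpos : 0 < κ := div_pos (by linarith) (by linarith)
  have hδ : 0 < (1 - σ ^ 2) / 4 - (κ ^ 2 + κ) * σ ^ 2 := turning_point_gap_pos hσpos hσσ₁
  have hlog : Real.log (1 / σ₁) ≤ Real.log (1 / σ) :=
    Real.log_le_log (one_div_pos.2 (by linarith)) (one_div_le_one_div_of_le hσpos hσσ₁.le)
  have hexp' : lpExponent (Real.sin θ) - ε / 2 <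
      1 / 2 * Real.log (1 / σ) + 1 / 2 * binomialExponent κ := by
    have h : lpExponent σ₁ = 1 / 2 * Real.log (1 / σ₁) + 1 / 2 * binomialExponent κ := rfl
    rw [h] at hexp
    linarith
  have hev := ((eventually_mul_log_add_le (3 / 2) (3 / 2 * Real.log (1 / σ) + binomialExponent κ
      + Real.log (1 + 1 / (Real.cos θ - √(1 - σ ^ 2))) + 1) (half_pos hε)).and
    (Filter.eventually_ge_atTop
      (5 + (1 + σ ^ 2) / ((1 - σ ^ 2) / 4 - (κ ^ 2 + κ) * σ ^ 2)))).natCast_atTop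
  obtain ⟨N, hN⟩ := Filter.eventually_atTop.1 hev
  refine ⟨N, fun n hn P hP => ?_⟩
  obtain ⟨hn1, hn2⟩ := hN n hn
  have hδn : (1 + σ ^ 2) / ((1 - σ ^ 2) / 4 - (κ ^ 2 + κ) * σ ^ 2) ≤ n - 5 := by linarith
  have hn5 : 0 ≤ (n : ℝ) - 5 := le_trans (by positivity) hδn
  rw [div_le_iff₀ hδ] at hδn
  have hmain := log_MLP_ge (m := (n : ℝ) - 2) (by linarith) hσpos (hσσ₁.trans h11) hκpos hcos hcos1
    (by nlinarith) (by nlinarith) (P := P)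
    (by rwa [show ((n : ℝ) - 2 - 1) / 2 = ((n : ℝ) - 3) / 2 by ring])
  have hlogn : Real.log (1 + ((n : ℝ) - 2)) ≤ Real.log n :=
    Real.log_le_log (by linarith) (by linarith)
  rw [← lpExponent_eq hsin, ge_iff_le, one_div_mul_eq_div, le_div_iff₀ (by linarith)]
  have := mul_le_mul_of_nonneg_right hexp'.le (by linarith : (0 : ℝ) ≤ n)
  linarith
end

section
/- Let n ≥ 5 be an integer, let t > 0, and let s ≥ 0 be an even integer such that the maximal root of the Jacobi polynomial P_{s+2}^{((n−5)/2,(n−5)/2)} does not exceed t. Then P_{s+2}(1)·P_{s+2}(t)/‖P_{s+2}‖₂² ≥ P_s(1)·P_s(t)/‖P_s‖₂². -/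
open Polynomial Set

/-- The Gegenbauer polynomials `C_k^{(l)}`, defined by their three-term recurrence. -/
noncomputable def gegenbauer (l : ℝ) : ℕ → ℝ[X]
  | 0 => 1
  | 1 => 2 * C l * X
  | k + 2 => C ((k : ℝ) + 2)⁻¹ *
      (2 * ((k : ℝ[X]) + 1 + C l) * X * gegenbauer l (k + 1)
        - ((k : ℝ[X]) + 2 * C l) * gegenbauer l k)

namespace gegenbauer

theorem recurrence (l : ℝ) (k : ℕ) :
    ((k : ℝ[X]) + 2) * gegenbauer l (k + 2) =
      2 * ((k : ℝ[X]) + 1 + C l) * X * gegenbauer l (k + 1)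
        - ((k : ℝ[X]) + 2 * C l) * gegenbauer l k := by
  have h : ((k : ℝ[X]) + 2) * C ((k : ℝ) + 2)⁻¹ = 1 := by
    have h2 : ((k : ℝ[X]) + 2) = C ((k : ℝ) + 2) := by simp [C_ofNat]
    rw [h2, ← C_mul, mul_inv_cancel₀ (by positivity), C_1]
  rw [gegenbauer, ← mul_assoc, h, one_mul]

theorem eval_recurrence (l : ℝ) (k : ℕ) (x : ℝ) :
    ((k : ℝ) + 2) * (gegenbauer l (k + 2)).eval x =
      2 * (k + 1 + l) * x * (gegenbauer l (k + 1)).eval x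
        - (k + 2 * l) * (gegenbauer l k).eval x := by
  simpa using congrArg (eval x) (recurrence l k)

theorem natDegree_le (l : ℝ) (k : ℕ) : (gegenbauer l k).natDegree ≤ k := by
  induction k using Nat.twoStepInduction with
  | zero => simp [gegenbauer]
  | one =>
    rw [gegenbauer, ← C_ofNat, ← C_mul]
    exact (natDegree_C_mul_le _ _).trans natDegree_X_le
  | more k h0 h1 =>
    have e1 : 2 * ((k : ℝ[X]) + 1 + C l) = C (2 * ((k : ℝ) + 1 + l)) := by simp [C_ofNat]
    have e2 : (k : ℝ[X]) + 2 * C l = C ((k : ℝ) + 2 * l) := by simp [C_ofNat]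
    rw [gegenbauer, e1, e2, mul_assoc]
    refine (natDegree_C_mul_le _ _).trans ((natDegree_sub_le _ _).trans (max_le ?_ ?_))
    · refine (natDegree_C_mul_le _ _).trans (natDegree_mul_le.trans ?_)
      rw [natDegree_X]
      omega
    · exact (natDegree_C_mul_le _ _).trans (by omega)

theorem derivative_succ_sub_and (l : ℝ) (k : ℕ) :
    derivative (gegenbauer l (k + 1)) - X * derivative (gegenbauer l k) =
        ((k : ℝ[X]) + 2 * C l) * gegenbauer l k ∧
      X * derivative (gegenbauer l (k + 1)) - derivative (gegenbauer l k) =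
        ((k : ℝ[X]) + 1) * gegenbauer l (k + 1) := by
  induction k with
  | zero => constructor <;> simp [gegenbauer, mul_comm X]
  | succ k ih =>
    obtain ⟨hA, hB⟩ := ih
    have hr := recurrence l k
    have hd := congrArg derivative hr
    simp only [derivative_mul, derivative_add, derivative_sub, derivative_natCast,
      derivative_ofNat, derivative_one, derivative_C, derivative_X] at hd
    have hk : (k : ℝ[X]) + 2 ≠ 0 := by exact_mod_cast (by omega : k + 2 ≠ 0)
    have hA' : derivative (gegenbauer l (k + 2)) - X * derivative (gegenbauer l (k + 1)) =
        (((k + 1 : ℕ) : ℝ[X]) + 2 * C l) * gegenbauer l (k + 1) := by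
      refine mul_left_cancel₀ hk ?_
      push_cast
      linear_combination hd + ((k : ℝ[X]) + 2 * C l) * hB
    refine ⟨hA', ?_⟩
    push_cast at hA' ⊢
    linear_combination X * hA' - hA + X * hB - hr

theorem derivative_succ_sub (l : ℝ) (k : ℕ) :
    derivative (gegenbauer l (k + 1)) - X * derivative (gegenbauer l k) =
      ((k : ℝ[X]) + 2 * C l) * gegenbauer l k :=
  (derivative_succ_sub_and l k).1

theorem X_mul_derivative_succ_sub (l : ℝ) (k : ℕ) :
    X * derivative (gegenbauer l (k + 1)) - derivative (gegenbauer l k) =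
      ((k : ℝ[X]) + 1) * gegenbauer l (k + 1) :=
  (derivative_succ_sub_and l k).2

/-- The Gegenbauer differential equation. -/
theorem differential_equation (l : ℝ) (k : ℕ) :
    (1 - X ^ 2) * derivative (derivative (gegenbauer l k)) -
        (2 * C l + 1) * X * derivative (gegenbauer l k) =
      -((k : ℝ[X]) * ((k : ℝ[X]) + 2 * C l)) * gegenbauer l k := by
  cases k with
  | zero => simp [gegenbauer]
  | succ k =>
    have hA := derivative_succ_sub l k
    have hB := X_mul_derivative_succ_sub l k
    have hC : (1 - X ^ 2) * derivative (gegenbauer l (k + 1)) =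
        ((k : ℝ[X]) + 2 * C l) * gegenbauer l k - ((k : ℝ[X]) + 1) * X * gegenbauer l (k + 1) := by
      linear_combination hA - X * hB
    have hd := congrArg derivative hC
    simp only [derivative_mul, derivative_add, derivative_sub, derivative_natCast,
      derivative_ofNat, derivative_one, derivative_C, derivative_X, derivative_X_pow] at hd
    push_cast at hd ⊢
    simp only [C_ofNat] at hd
    linear_combination hd - ((k : ℝ[X]) + 2 * C l) * hB

theorem derivative_succ (m : ℝ) (k : ℕ) :
    derivative (gegenbauer m (k + 1)) = 2 * C m * gegenbauer (m + 1) k := by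
  induction k using Nat.twoStepInduction with
  | zero => simp [gegenbauer]
  | one =>
    have h := derivative_succ_sub m 1
    simp [gegenbauer] at h ⊢
    linear_combination h
  | more k h0 h1 =>
    have hk : (k : ℝ[X]) + 2 ≠ 0 := by exact_mod_cast (by omega : k + 2 ≠ 0)
    have hA := derivative_succ_sub m (k + 2)
    have hB := X_mul_derivative_succ_sub m (k + 1)
    have hr := recurrence (m + 1) k
    rw [h1] at hA hB
    rw [h0] at hB
    refine mul_left_cancel₀ hk ?_
    push_cast [map_add, map_one] at hA hB hr
    linear_combination ((k : ℝ[X]) + 2) * hA - ((k : ℝ[X]) + 2 + 2 * C m) * hB - 2 * C m * hr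

theorem eval_raise (m : ℝ) (k : ℕ) (x : ℝ) :
    (k + 2 + m) * (gegenbauer m (k + 2)).eval x =
      m * ((gegenbauer (m + 1) (k + 2)).eval x - (gegenbauer (m + 1) k).eval x) := by
  have hA := congrArg (eval x) (derivative_succ_sub m (k + 2))
  have hB := congrArg (eval x) (X_mul_derivative_succ_sub m (k + 1))
  rw [derivative_succ, derivative_succ] at hA hB
  simp at hA hB
  linear_combination -(hA + hB) / 2

theorem eval_pos_and_mul_le {l : ℝ} (hl : 0 < l) {x : ℝ} (hx : 1 ≤ x) (k : ℕ) :
    0 < (gegenbauer l k).eval x ∧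
      (k + 2 * l) * (gegenbauer l k).eval x ≤ (k + 1) * (gegenbauer l (k + 1)).eval x := by
  induction k with
  | zero =>
    simp only [gegenbauer, eval_one, eval_mul, eval_ofNat, eval_C, eval_X, CharP.cast_eq_zero]
    constructor <;> nlinarith
  | succ k ih =>
    obtain ⟨h0, h1⟩ := ih
    have hpos : 0 < (gegenbauer l (k + 1)).eval x := by
      have : 0 < ((k : ℝ) + 1) * (gegenbauer l (k + 1)).eval x := lt_of_lt_of_le (by positivity) h1
      exact pos_of_mul_pos_right this (by positivity)
    refine ⟨hpos, ?_⟩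
    have hr := eval_recurrence l k x
    have : 0 ≤ 2 * (k + 1 + l) * (x - 1) * (gegenbauer l (k + 1)).eval x :=
      mul_nonneg (mul_nonneg (by positivity) (by linarith)) hpos.le
    push_cast
    rw [show k + 1 + 1 = k + 2 from rfl]
    linarith

theorem eval_pos {l : ℝ} (hl : 0 < l) {x : ℝ} (hx : 1 ≤ x) (k : ℕ) :
    0 < (gegenbauer l k).eval x :=
  (eval_pos_and_mul_le hl hx k).1

theorem eval_one_succ (l : ℝ) (k : ℕ) :
    ((k : ℝ) + 1) * (gegenbauer l (k + 1)).eval 1 = (k + 2 * l) * (gegenbauer l k).eval 1 := by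
  induction k with
  | zero => simp [gegenbauer]
  | succ k ih =>
    have hr := eval_recurrence l k 1
    push_cast
    linear_combination hr + ih

end gegenbauer

theorem continuous_one_sub_sq_rpow {a : ℝ} (ha : 0 ≤ a) :
    Continuous fun t : ℝ => (1 - t ^ 2) ^ a :=
  Continuous.rpow_const (by fun_prop) fun _ => Or.inr ha

theorem intervalIntegrable_eval_mul_rpow {a : ℝ} (ha : 0 ≤ a) (p : ℝ[X]) :
    IntervalIntegrable (fun t => p.eval t * (1 - t ^ 2) ^ a) MeasureTheory.volume (-1) 1 :=
  (p.continuous.mul (continuous_one_sub_sq_rpow ha)).intervalIntegrable _ _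

/-- Integration of polynomials against the Jacobi weight `(1 - t²)^a` on `(-1, 1)`. -/
noncomputable def jacobiIntegral {a : ℝ} (ha : 0 ≤ a) : ℝ[X] →ₗ[ℝ] ℝ where
  toFun p := ∫ t in (-1 : ℝ)..1, p.eval t * (1 - t ^ 2) ^ a
  map_add' p q := by
    simp only [eval_add, add_mul]
    exact intervalIntegral.integral_add (intervalIntegrable_eval_mul_rpow ha p)
      (intervalIntegrable_eval_mul_rpow ha q)
  map_smul' c p := by
    simp only [eval_smul, smul_eq_mul, mul_assoc, RingHom.id_apply]
    exact intervalIntegral.integral_const_mul _ _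

theorem jacobiIntegral_apply {a : ℝ} (ha : 0 ≤ a) (p : ℝ[X]) :
    jacobiIntegral ha p = ∫ t in (-1 : ℝ)..1, p.eval t * (1 - t ^ 2) ^ a := rfl

theorem hasDerivAt_one_sub_sq_rpow_mul {a : ℝ} (ha : 0 ≤ a) (q : ℝ[X]) {x : ℝ}
    (hx : 0 ≤ 1 - x ^ 2) :
    HasDerivAt (fun t : ℝ => (1 - t ^ 2) ^ (a + 1) * q.eval t)
      (((1 - X ^ 2) * derivative q - (2 * C a + 2) * X * q).eval x * (1 - x ^ 2) ^ a) x := by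
  have h1 : HasDerivAt (fun t : ℝ => 1 - t ^ 2) (-(2 * x)) x := by
    simpa using (hasDerivAt_pow 2 x).const_sub 1
  have h2 := (h1.rpow_const (p := a + 1) (Or.inr (by linarith))).mul (q.hasDerivAt x)
  refine h2.congr_deriv ?_
  have h3 : (1 - x ^ 2) ^ (a + 1) = (1 - x ^ 2) ^ a * (1 - x ^ 2) := by
    rw [Real.rpow_add_one' hx (by linarith)]
  simp [h3]
  ring

theorem jacobiIntegral_derivative {a : ℝ} (ha : 0 ≤ a) (q : ℝ[X]) :
    jacobiIntegral ha ((1 - X ^ 2) * derivative q - (2 * C a + 2) * X * q) = 0 := by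
  rw [jacobiIntegral_apply]
  have h := intervalIntegral.integral_eq_sub_of_hasDerivAt (a := -1) (b := 1)
    (f := fun t : ℝ => (1 - t ^ 2) ^ (a + 1) * q.eval t)
    (fun x hx => hasDerivAt_one_sub_sq_rpow_mul ha q (x := x) ?_)
    (intervalIntegrable_eval_mul_rpow ha _)
  · rw [h]
    simp [Real.zero_rpow (by linarith : a + 1 ≠ 0)]
  · rw [uIcc_of_le (by norm_num)] at hx
    nlinarith [hx.1, hx.2]

theorem jacobiIntegral_sq_nonneg {a : ℝ} (ha : 0 ≤ a) (p : ℝ[X]) :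
    0 ≤ jacobiIntegral ha (p ^ 2) := by
  rw [jacobiIntegral_apply]
  refine intervalIntegral.integral_nonneg (by norm_num) fun t ht => ?_
  rw [eval_pow]
  exact mul_nonneg (sq_nonneg _) (Real.rpow_nonneg (by nlinarith [ht.1, ht.2]) _)

theorem jacobiIntegral_sq_pos {a : ℝ} (ha : 0 ≤ a) {p : ℝ[X]} (hp : p ≠ 0) :
    0 < jacobiIntegral ha (p ^ 2) := by
  rw [jacobiIntegral_apply]
  obtain ⟨c, hc, hpc⟩ : ∃ c ∈ Ioo (-1 : ℝ) 1, p.eval c ≠ 0 := by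
    by_contra! h
    exact hp (eq_zero_of_infinite_isRoot p ((Ioo_infinite (by norm_num)).mono h))
  refine intervalIntegral.integral_pos (by norm_num)
    ((p ^ 2).continuous.mul (continuous_one_sub_sq_rpow ha)).continuousOn
    (fun t ht => ?_) ⟨c, Ioo_subset_Icc_self hc, ?_⟩
  · rw [eval_pow]
    exact mul_nonneg (sq_nonneg _) (Real.rpow_nonneg (by nlinarith [ht.1, ht.2]) _)
  · rw [eval_pow]
    exact mul_pos (by positivity) (Real.rpow_pos_of_pos (by nlinarith [hc.1, hc.2]) _)

theorem jacobiIntegral_mul_eq_zero {a : ℝ} (ha : 0 ≤ a) {p q : ℝ[X]} {k : ℕ}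
    (h : ∀ j < k, jacobiIntegral ha (p * X ^ j) = 0) (hq : q.degree < k) :
    jacobiIntegral ha (p * q) = 0 := by
  rcases eq_or_ne q 0 with rfl | hq0
  · simp
  have hk := (natDegree_lt_iff_degree_lt hq0).2 hq
  rw [q.as_sum_range_C_mul_X_pow, Finset.mul_sum, map_sum]
  refine Finset.sum_eq_zero fun j hj => ?_
  rw [mul_left_comm, C_mul', map_smul, h j (by simp at hj; omega), smul_zero]

theorem jacobiIntegral_gegenbauer_mul_X_pow {a : ℝ} (ha : 0 ≤ a) (k : ℕ) :
    ∀ j < k, jacobiIntegral ha (gegenbauer (a + 1 / 2) k * X ^ j) = 0 := by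
  intro j
  induction j using Nat.strong_induction_on with
  | _ j ih =>
    intro hj
    have hode := gegenbauer.differential_equation (a + 1 / 2) k
    set g := gegenbauer (a + 1 / 2) k
    have hl : 2 * (C (a + 1 / 2) : ℝ[X]) = 2 * C a + 1 := by
      rw [← C_ofNat, ← C_mul, ← C_mul, ← C_1, ← C_add]
      congr 1
      ring
    rw [hl] at hode
    have h1 := jacobiIntegral_derivative ha (derivative g * X ^ j - g * derivative (X ^ j))
    have hlow : jacobiIntegral ha (g * derivative (derivative (X ^ j))) = 0 := by
      rcases lt_or_ge j 2 with h2 | h2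
      · interval_cases j <;> simp
      · obtain ⟨i, rfl⟩ := Nat.exists_eq_add_of_le' h2
        have : g * derivative (derivative (X ^ (i + 2))) =
            (((i : ℝ) + 2) * (i + 1)) • (g * X ^ i) := by
          rw [← C_mul']
          simp [C_ofNat]
          ring
        rw [this, map_smul, ih i (by omega) (by omega), smul_zero]
    have hX : X * derivative (X ^ j : ℝ[X]) = (j : ℝ[X]) * X ^ j := by
      cases j with
      | zero => simp
      | succ j => simp; ring
    have hX2 : X ^ 2 * derivative (derivative (X ^ j : ℝ[X])) = (j : ℝ[X]) * ((j : ℝ[X]) - 1) * X ^ j := by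
      have h := congrArg derivative hX
      simp only [derivative_mul, derivative_X, derivative_natCast] at h
      linear_combination X * h + ((j : ℝ[X]) - 1) * hX
    have h2 : (1 - X ^ 2) * derivative (derivative g * X ^ j - g * derivative (X ^ j)) -
          (2 * C a + 2) * X * (derivative g * X ^ j - g * derivative (X ^ j)) =
        (-(k * (k + 2 * a + 1) - j * (j + 2 * a + 1)) : ℝ) • (g * X ^ j) -
          g * derivative (derivative (X ^ j)) := by
      rw [← C_mul']
      simp only [derivative_mul, map_add, map_neg, map_sub, map_mul, map_natCast,
        C_ofNat, C_1]
      linear_combination X ^ j * hode + g * hX2 + (2 * C a + 2) * g * hX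
    rw [h2, map_sub, map_smul, hlow, sub_zero, smul_eq_mul] at h1
    refine (mul_eq_zero.1 h1).resolve_left ?_
    have hjk : (j : ℝ) < k := by exact_mod_cast hj
    have hj0 : (0 : ℝ) ≤ j := by positivity
    nlinarith

theorem jacobiIntegral_gegenbauer_mul {a : ℝ} (ha : 0 ≤ a) {j k : ℕ} (hjk : j < k) :
    jacobiIntegral ha (gegenbauer (a + 1 / 2) k * gegenbauer (a + 1 / 2) j) = 0 :=
  jacobiIntegral_mul_eq_zero ha (jacobiIntegral_gegenbauer_mul_X_pow ha k)
    (lt_of_le_of_lt (degree_le_of_natDegree_le (gegenbauer.natDegree_le _ j))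
      (by exact_mod_cast hjk))

theorem gegenbauer_ne_zero {l : ℝ} (hl : 0 < l) (k : ℕ) : gegenbauer l k ≠ 0 := by
  intro h
  simpa [h] using gegenbauer.eval_pos hl le_rfl k

theorem IsJacobi.exists_gegenbauer_eq {a : ℝ} (ha : 0 ≤ a) {k : ℕ} {P : ℝ[X]}
    (hP : IsJacobi a k P) : ∃ c : ℝ, c ≠ 0 ∧ gegenbauer (a + 1 / 2) k = C c * P := by
  obtain ⟨hdeg, horth, -⟩ := hP
  have hg := gegenbauer_ne_zero (by linarith : 0 < a + 1 / 2) k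
  have hgd := gegenbauer.natDegree_le (a + 1 / 2) k
  have hgo := jacobiIntegral_gegenbauer_mul_X_pow ha k
  set g := gegenbauer (a + 1 / 2) k
  have hPk : P.coeff k ≠ 0 := coeff_ne_zero_of_eq_degree hdeg
  have hPd : P.natDegree ≤ k := natDegree_le_of_degree_le hdeg.le
  set c := g.coeff k / P.coeff k with hc
  have hd : (g - C c * P).degree < k := by
    rw [degree_lt_iff_coeff_zero]
    intro m hm
    rcases hm.eq_or_lt with rfl | hm
    · simp [hc, hPk]
    · simp [coeff_eq_zero_of_natDegree_lt (hgd.trans_lt hm),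
        coeff_eq_zero_of_natDegree_lt (hPd.trans_lt hm)]
  have hdo : ∀ j < k, jacobiIntegral ha ((g - C c * P) * X ^ j) = 0 := by
    intro j hj
    have hPj : jacobiIntegral ha (P * X ^ j) = 0 := by
      simpa [jacobiIntegral_apply] using horth j hj
    rw [sub_mul, mul_assoc, C_mul', map_sub, map_smul, hgo j hj, hPj]
    simp
  have hzero : g - C c * P = 0 := by
    by_contra hne
    have h := jacobiIntegral_sq_pos ha hne
    rw [sq, jacobiIntegral_mul_eq_zero ha hdo hd] at h
    exact h.false
  have heq : g = C c * P := sub_eq_zero.1 hzero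
  refine ⟨c, fun h0 => hg ?_, heq⟩
  rw [heq, h0, C_0, zero_mul]

theorem jacobiIntegral_X_mul_gegenbauer {a : ℝ} (ha : 0 ≤ a) (k : ℕ) :
    2 * (k + 1 + (a + 1 / 2)) * jacobiIntegral ha
        (X * gegenbauer (a + 1 / 2) (k + 1) * gegenbauer (a + 1 / 2) k) =
      (k + 2 * (a + 1 / 2)) * jacobiIntegral ha (gegenbauer (a + 1 / 2) k ^ 2) ∧
    ((k : ℝ) + 1) * jacobiIntegral ha (gegenbauer (a + 1 / 2) (k + 1) ^ 2) =
      2 * (k + (a + 1 / 2)) * jacobiIntegral ha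
        (X * gegenbauer (a + 1 / 2) (k + 1) * gegenbauer (a + 1 / 2) k) := by
  set l := a + 1 / 2
  constructor
  · have h : (2 * (k + 1 + l)) • (X * gegenbauer l (k + 1) * gegenbauer l k) =
        (k + 2 * l) • (gegenbauer l k ^ 2) +
          ((k : ℝ) + 2) • (gegenbauer l (k + 2) * gegenbauer l k) := by
      simp only [← C_mul', map_add, map_mul, map_natCast, C_ofNat, C_1]
      linear_combination -gegenbauer l k * gegenbauer.recurrence l k
    have h' := congrArg (jacobiIntegral ha) h
    rw [map_add, map_smul, map_smul, map_smul,
      jacobiIntegral_gegenbauer_mul ha (by omega : k < k + 2)] at h'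
    simpa using h'
  · cases k with
    | zero =>
      have h : gegenbauer l 1 ^ 2 = (2 * l) • (X * gegenbauer l 1 * gegenbauer l 0) := by
        simp only [← C_mul', gegenbauer, map_mul, C_ofNat]
        ring
      have h' := congrArg (jacobiIntegral ha) h
      rw [map_smul] at h'
      simpa using h'
    | succ k =>
      have h : ((k : ℝ) + 2) • (gegenbauer l (k + 2) ^ 2) =
          (2 * (k + 1 + l)) • (X * gegenbauer l (k + 2) * gegenbauer l (k + 1)) -
            (k + 2 * l) • (gegenbauer l (k + 2) * gegenbauer l k) := by
        simp only [← C_mul', map_add, map_mul, map_natCast, C_ofNat, C_1]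
        linear_combination gegenbauer l (k + 2) * gegenbauer.recurrence l k
      have h' := congrArg (jacobiIntegral ha) h
      rw [map_sub, map_smul, map_smul, map_smul,
        jacobiIntegral_gegenbauer_mul ha (by omega : k < k + 2)] at h'
      simp only [smul_eq_mul] at h'
      push_cast
      linear_combination h'

theorem gegenbauer_eval_one_mul {a : ℝ} (ha : 0 ≤ a) (k : ℕ) :
    (gegenbauer (a + 1 / 2) k).eval 1 * ((a + 1 / 2) * jacobiIntegral ha 1) =
      (k + (a + 1 / 2)) * jacobiIntegral ha (gegenbauer (a + 1 / 2) k ^ 2) := by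
  induction k with
  | zero => simp [gegenbauer]
  | succ k ih =>
    obtain ⟨h1, h2⟩ := jacobiIntegral_X_mul_gegenbauer ha k
    have h3 := gegenbauer.eval_one_succ (a + 1 / 2) k
    have hk : (0 : ℝ) < k + 1 := by positivity
    refine mul_left_cancel₀ hk.ne' ?_
    push_cast
    linear_combination ((a + 1 / 2) * jacobiIntegral ha 1) * h3 + (k + 2 * (a + 1 / 2)) * ih
      - (k + 1 + (a + 1 / 2)) * h2 - (k + (a + 1 / 2)) * h1

theorem IsJacobi.eval_mul_div_jNorm {n k : ℕ} (ha : 0 ≤ ((n : ℝ) - 3) / 2) {P : ℝ[X]}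
    (hP : IsJacobi (((n : ℝ) - 3) / 2) k P) (t : ℝ) :
    P.eval 1 * P.eval t / jNorm n P ^ 2 =
      (k + (((n : ℝ) - 3) / 2 + 1 / 2)) * (gegenbauer (((n : ℝ) - 3) / 2 + 1 / 2) k).eval t /
        ((((n : ℝ) - 3) / 2 + 1 / 2) * jacobiIntegral ha 1) := by
  obtain ⟨c, hc, hg⟩ := hP.exists_gegenbauer_eq ha
  have hnorm : jNorm n P ^ 2 = jacobiIntegral ha (P ^ 2) := by
    have h : (∫ t in (-1 : ℝ)..1, P.eval t ^ 2 * jWeight n t) = jacobiIntegral ha (P ^ 2) := by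
      simp [jacobiIntegral_apply, jWeight]
    rw [jNorm, h, Real.sq_sqrt (jacobiIntegral_sq_nonneg ha P)]
  have hP0 : P ≠ 0 := by
    rintro rfl
    exact gegenbauer_ne_zero (by linarith : 0 < ((n : ℝ) - 3) / 2 + 1 / 2) k (by simpa using hg)
  have hPpos := jacobiIntegral_sq_pos ha hP0
  have h1pos : 0 < jacobiIntegral ha 1 := by
    simpa using jacobiIntegral_sq_pos ha (one_ne_zero (α := ℝ[X]))
  have hmain := gegenbauer_eval_one_mul ha k
  have hsq : jacobiIntegral ha ((C c * P) ^ 2) = c ^ 2 * jacobiIntegral ha (P ^ 2) := by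
    rw [mul_pow, ← C_pow, C_mul', map_smul, smul_eq_mul]
  rw [hg, hsq, eval_mul, eval_C] at hmain
  have hmain' : P.eval 1 * ((((n : ℝ) - 3) / 2 + 1 / 2) * jacobiIntegral ha 1) =
      (k + (((n : ℝ) - 3) / 2 + 1 / 2)) * (c * jacobiIntegral ha (P ^ 2)) := by
    refine mul_left_cancel₀ hc ?_
    linear_combination hmain
  have hl : 0 < ((n : ℝ) - 3) / 2 + 1 / 2 := by linarith
  rw [hnorm, hg, eval_mul, eval_C, div_eq_div_iff hPpos.ne' (mul_pos hl h1pos).ne']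
  linear_combination P.eval t * hmain'

/-- A Gegenbauer polynomial is nonnegative to the right of its largest root. -/
theorem gegenbauer_eval_nonneg_of_upperBound {l : ℝ} (hl : 0 < l) {k : ℕ} {ρ x : ℝ}
    (hρ : ∀ u, (gegenbauer l k).eval u = 0 → u ≤ ρ) (hx : ρ ≤ x) :
    0 ≤ (gegenbauer l k).eval x := by
  by_contra! hneg
  have hx1 : x < 1 := by
    by_contra! h
    exact (gegenbauer.eval_pos hl h k).not_gt hneg
  obtain ⟨u, hu, hu0⟩ := intermediate_value_Ioo hx1.le (gegenbauer l k).continuous.continuousOn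
    ⟨hneg, gegenbauer.eval_pos hl le_rfl k⟩
  exact (hx.trans_lt hu.1).not_ge (hρ u hu0)

/-- A Gegenbauer polynomial is nondecreasing to the right of its largest root. -/
theorem gegenbauer_derivative_eval_nonneg {b : ℝ} (hb : 0 ≤ b) {k : ℕ} {ρ t : ℝ}
    (hρ : ∀ u, (gegenbauer (b + 1 / 2) k).eval u = 0 → u ≤ ρ) (hρt : ρ ≤ t) (ht : 0 < t)
    (ht1 : t < 1) : 0 ≤ (derivative (gegenbauer (b + 1 / 2) k)).eval t := by
  have hode := gegenbauer.differential_equation (b + 1 / 2) k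
  have hnn := fun x hx => gegenbauer_eval_nonneg_of_upperBound (x := x)
    (by linarith : 0 < b + 1 / 2) hρ hx
  set f := gegenbauer (b + 1 / 2) k
  have hder : ∀ x ∈ Icc t 1, HasDerivAt
      (fun y : ℝ => (1 - y ^ 2) ^ (b + 1) * (derivative f).eval y)
      (-(k * (k + 2 * b + 1)) * f.eval x * (1 - x ^ 2) ^ b) x := by
    intro x hx
    refine (hasDerivAt_one_sub_sq_rpow_mul hb (derivative f)
      (by nlinarith [hx.1, hx.2])).congr_deriv ?_
    have h := congrArg (eval x) hode
    simp at h ⊢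
    linear_combination (1 - x ^ 2) ^ b * h
  have hanti : AntitoneOn (fun y : ℝ => (1 - y ^ 2) ^ (b + 1) * (derivative f).eval y)
      (Icc t 1) := by
    refine antitoneOn_of_deriv_nonpos (convex_Icc t 1)
      (fun x hx => (hder x hx).continuousAt.continuousWithinAt)
      (fun x hx => (hder x (interior_subset hx)).differentiableAt.differentiableWithinAt)
      fun x hx => ?_
    have hx' := interior_subset hx
    rw [(hder x hx').deriv]
    have h1 := hnn x (hρt.trans hx'.1)
    have h2 : 0 ≤ (1 - x ^ 2) ^ b := Real.rpow_nonneg (by nlinarith [hx'.1, hx'.2]) _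
    have h3 : 0 ≤ (k * (k + 2 * b + 1)) * f.eval x * (1 - x ^ 2) ^ b := by positivity
    linarith
  have h := hanti (left_mem_Icc.2 ht1.le) (right_mem_Icc.2 ht1.le) ht1.le
  simp only [one_pow, sub_self, Real.zero_rpow (by linarith : b + 1 ≠ 0), zero_mul] at h
  exact nonneg_of_mul_nonneg_right h (Real.rpow_pos_of_pos (by nlinarith) _)

/-- `(k + m + 1) C_k^{(m+1)}(t)` increases from `k` to `k + 2` when `t` is at least the largest
root of `C_{k+2}^{(m)}`. -/
theorem gegenbauer_weighted_le {b : ℝ} (hb : 0 ≤ b) {k : ℕ} {ρ t : ℝ}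
    (hρ : ∀ u, (gegenbauer (b + 1 / 2) (k + 2)).eval u = 0 → u ≤ ρ) (hρt : ρ ≤ t)
    (ht : 0 < t) :
    (k + (b + 1 / 2 + 1)) * (gegenbauer (b + 1 / 2 + 1) k).eval t ≤
      (k + 2 + (b + 1 / 2 + 1)) * (gegenbauer (b + 1 / 2 + 1) (k + 2)).eval t := by
  have hm : 0 < b + 1 / 2 := by linarith
  have hmid : 0 ≤ (gegenbauer (b + 1 / 2 + 1) (k + 1)).eval t := by
    rcases le_or_gt 1 t with ht1 | ht1
    · exact (gegenbauer.eval_pos (by linarith) ht1 _).le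
    · have h := gegenbauer_derivative_eval_nonneg hb hρ hρt ht ht1
      rw [gegenbauer.derivative_succ] at h
      simp only [eval_mul, eval_ofNat, eval_C] at h
      exact nonneg_of_mul_nonneg_right h (by positivity)
  have hraise := gegenbauer.eval_raise (b + 1 / 2) k t
  have hrec := gegenbauer.eval_recurrence (b + 1 / 2 + 1) k t
  have hnn := gegenbauer_eval_nonneg_of_upperBound hm hρ hρt
  have hle : (gegenbauer (b + 1 / 2 + 1) k).eval t ≤
      (gegenbauer (b + 1 / 2 + 1) (k + 2)).eval t := by
    have h : 0 ≤ (b + 1 / 2) * ((gegenbauer (b + 1 / 2 + 1) (k + 2)).eval t -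
        (gegenbauer (b + 1 / 2 + 1) k).eval t) := by
      rw [← hraise]
      positivity
    linarith [nonneg_of_mul_nonneg_right h hm]
  generalize (gegenbauer (b + 1 / 2 + 1) k).eval t = u at *
  generalize (gegenbauer (b + 1 / 2 + 1) (k + 2)).eval t = v at *
  generalize (gegenbauer (b + 1 / 2 + 1) (k + 1)).eval t = w at *
  have hv : 0 ≤ v := by
    have h1 : 0 ≤ 2 * (k + 1 + (b + 1 / 2 + 1)) * t * w := by positivity
    have h2 : (k + 2 * (b + 1 / 2 + 1)) * u ≤ (k + 2 * (b + 1 / 2 + 1)) * v :=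
      mul_le_mul_of_nonneg_left hle (by positivity)
    have h3 : 0 ≤ (2 * k + 2 + 2 * (b + 1 / 2 + 1)) * v := by linarith
    exact nonneg_of_mul_nonneg_right h3 (by positivity)
  have h4 : (k + (b + 1 / 2 + 1)) * u ≤ (k + (b + 1 / 2 + 1)) * v :=
    mul_le_mul_of_nonneg_left hle (by positivity)
  linarith

/-- Lemma 2.6: for `t > 0` and even `s` such that the maximal root of the
Jacobi polynomial `P_{s+2}^{((n-5)/2,(n-5)/2)}` (the family `Q`) does not
exceed `t`, the quantity `P_s(1) P_s(t)/‖P_s‖₂²` is increasing from `s` to `s+2`. -/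
theorem design_monotone (n : ℕ) (hn : 5 ≤ n)
    (P Q : ℕ → Polynomial ℝ)
    (hP : ∀ s, IsJacobi (((n : ℝ) - 3) / 2) s (P s))
    (hQ : ∀ s, IsJacobi (((n : ℝ) - 5) / 2) s (Q s))
    (t : ℝ) (ht : 0 < t) (s : ℕ) (hs : Even s)
    (ρ : ℝ) (hρ : IsGreatest {u : ℝ | (Q (s + 2)).eval u = 0} ρ) (hρt : ρ ≤ t) :
    (P s).eval 1 * (P s).eval t / (jNorm n (P s)) ^ 2 ≤
      (P (s + 2)).eval 1 * (P (s + 2)).eval t / (jNorm n (P (s + 2))) ^ 2 := by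
  have hn' : (5 : ℝ) ≤ n := by exact_mod_cast hn
  have ha : 0 ≤ ((n : ℝ) - 3) / 2 := by linarith
  have hb : 0 ≤ ((n : ℝ) - 5) / 2 := by linarith
  have hl : ((n : ℝ) - 3) / 2 + 1 / 2 = ((n : ℝ) - 5) / 2 + 1 / 2 + 1 := by ring
  obtain ⟨c, hc, hg⟩ := (hQ (s + 2)).exists_gegenbauer_eq hb
  have hroots : ∀ u, (gegenbauer (((n : ℝ) - 5) / 2 + 1 / 2) (s + 2)).eval u = 0 → u ≤ ρ := by
    intro u hu
    rw [hg, eval_mul, eval_C] at hu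
    exact hρ.2 ((mul_eq_zero.1 hu).resolve_left hc)
  have h1pos : 0 < jacobiIntegral ha 1 := by
    simpa using jacobiIntegral_sq_pos ha (one_ne_zero (α := ℝ[X]))
  rw [(hP s).eval_mul_div_jNorm ha, (hP (s + 2)).eval_mul_div_jNorm ha]
  refine div_le_div_of_nonneg_right ?_ (mul_nonneg (by linarith) h1pos.le)
  rw [hl]
  push_cast
  exact gegenbauer_weighted_le hb hroots hρt ht
end
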